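/- Let A_Γ be a large-type Artin group, let Λ, Λ' be subsets of the vertices of Γ with |Λ| ≥ 2, and let A_Λ, A_{Λ'} be the corresponding standard parabolic subgroups. If g ∈ A_Γ satisfies g A_Λ g⁻¹ = A_{Λ'}, then Λ = Λ' and g ∈ A_Λ. -/

import Mathlib

/-- The alternating product `a * b * a * ⋯` with `n` factors. -/
def altProd {M : Type*} [Monoid M] : M → M → ℕ → M
  | _, _, 0 => 1
  | a, b, n + 1 => a * altProd b a n

/-- A defining graph: a finite simplicial graph with each edge labelled by a natural
number `≥ 2`. -/
structure DefiningGraph (V : Type*) where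
  graph : SimpleGraph V
  label : V → V → ℕ
  label_symm : ∀ a b, label a b = label b a
  two_le_label : ∀ a b, graph.Adj a b → 2 ≤ label a b

/-- The Artin relations `π(a,b;m_ab) = π(b,a;m_ab)`, one for each edge `{a,b}` of the
defining graph. -/
def DefiningGraph.rels {V : Type*} (Γ : DefiningGraph V) : Set (FreeGroup V) :=
  {r | ∃ a b, Γ.graph.Adj a b ∧
    r = altProd (FreeGroup.of a) (FreeGroup.of b) (Γ.label a b) *
      (altProd (FreeGroup.of b) (FreeGroup.of a) (Γ.label a b))⁻¹}

/-- The Artin group of a defining graph, as a presented group. The standard generator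
corresponding to a vertex `v` is `PresentedGroup.of v`. -/
abbrev ArtinGroup {V : Type*} (Γ : DefiningGraph V) : Type _ := PresentedGroup Γ.rels

/-- The standard parabolic subgroup of `A_Γ` generated by the standard generators in `S`. -/
def parabolic {V : Type*} (Γ : DefiningGraph V) (S : Set V) : Subgroup (ArtinGroup Γ) :=
  Subgroup.closure ((PresentedGroup.of : V → ArtinGroup Γ) '' S)

/-- A family of groups indexed by pairs of vertices, each with a length function for which
every coset of a cyclic standard subgroup has a unique shortest element, together with
compatible homomorphisms to an ambient group `A` with distinguished elements `a x`. -/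
structure LocalSystem (V : Type*) (A : Type*) [Group A] (a : V → A) where
  G : Sym2 V → Type
  [grp : ∀ X, Group (G X)]
  gen : ∀ X, V → G X
  len : ∀ X, G X → ℕ
  j : ∀ X, G X →* A
  j_gen : ∀ X x, ¬ X.IsDiag → x ∈ X → j X (gen X x) = a x
  len_one : ∀ X, len X 1 = 0
  exists_gate : ∀ X x w, ∃ (n : ℤ) (w₀ : G X), w = gen X x ^ n * w₀ ∧
    ∀ k : ℤ, len X (gen X x ^ k * w₀) = len X w₀ + k.natAbs
  eq_one : ∀ X (w : G X), ¬ X.IsDiag →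
    (∀ x ∈ X, ∀ k : ℤ, len X (gen X x ^ k * w) = len X w + k.natAbs) → w = 1
  sep : ∀ X x y, ¬ X.IsDiag → x ∈ X → y ∈ X → x ≠ y → ∀ n i : ℤ, n ≠ 0 →
    ∀ k : ℤ, len X (gen X y ^ k * (gen X x ^ n * gen X y ^ i)) =
      len X (gen X x ^ n * gen X y ^ i) + k.natAbs

namespace LocalSystem

variable {V : Type*} {A : Type*} [Group A] {a : V → A} (S : LocalSystem V A a)

instance (X : Sym2 V) : Group (S.G X) := S.grp X

/-- `w` is shortest in its coset `⟨x⟩ w`. -/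
def LMin (X : Sym2 V) (x : V) (w : S.G X) : Prop :=
  ∀ k : ℤ, S.len X (S.gen X x ^ k * w) = S.len X w + k.natAbs

/-- The exponent of `x` in `w`. -/
noncomputable def ex (X : Sym2 V) (x : V) (w : S.G X) : ℤ := (S.exists_gate X x w).choose

/-- The shortest element of the coset `⟨x⟩ w`. -/
noncomputable def gate (X : Sym2 V) (x : V) (w : S.G X) : S.G X :=
  (S.exists_gate X x w).choose_spec.choose

/-- Every vertex of `X` occurs as a first letter of `w`. -/
def Two (X : Sym2 V) (w : S.G X) : Prop := ∀ x ∈ X, S.ex X x w ≠ 0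

variable {S} {X : Sym2 V} {x y : V} {w w₀ : S.G X} {n : ℤ}

theorem gate_spec (X : Sym2 V) (x : V) (w : S.G X) :
    S.gen X x ^ S.ex X x w * S.gate X x w = w :=
  (S.exists_gate X x w).choose_spec.choose_spec.1.symm

theorem gate_min (X : Sym2 V) (x : V) (w : S.G X) : S.LMin X x (S.gate X x w) :=
  (S.exists_gate X x w).choose_spec.choose_spec.2

theorem ex_gate_of_min (h : S.LMin X x w₀) (n : ℤ) :
    S.ex X x (S.gen X x ^ n * w₀) = n ∧ S.gate X x (S.gen X x ^ n * w₀) = w₀ := by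
  set w := S.gen X x ^ n * w₀ with hw
  have h1 := gate_spec X x w
  have h2 := gate_min X x w
  set m := S.ex X x w
  set g := S.gate X x w
  have e1 : g = S.gen X x ^ (n - m) * w₀ := by
    rw [zpow_sub, ← zpow_neg, (Commute.refl (S.gen X x)).zpow_zpow n (-m) |>.eq, mul_assoc,
      ← hw, ← h1, zpow_neg, inv_mul_cancel_left]
  have e2 : w₀ = S.gen X x ^ (m - n) * g := by
    rw [e1, ← mul_assoc, ← zpow_add]; simp
  have l1 := h (n - m)
  have l2 := h2 (m - n)
  rw [← e1] at l1
  rw [← e2] at l2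
  have : n = m := by omega
  refine ⟨this.symm, ?_⟩
  rw [e1, this]; simp

theorem ex_of_min (h : S.LMin X x w₀) (n : ℤ) : S.ex X x (S.gen X x ^ n * w₀) = n :=
  (ex_gate_of_min h n).1

theorem gate_of_min (h : S.LMin X x w₀) (n : ℤ) : S.gate X x (S.gen X x ^ n * w₀) = w₀ :=
  (ex_gate_of_min h n).2

theorem ex_eq_zero_iff : S.ex X x w = 0 ↔ S.LMin X x w := by
  constructor
  · intro h
    have := gate_min X x w
    have h2 := gate_spec X x w
    rw [h] at h2
    simp only [zpow_zero, one_mul] at h2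
    rwa [h2] at this
  · intro h
    simpa using ex_of_min h 0

theorem gate_of_ex_eq_zero (h : S.ex X x w = 0) : S.gate X x w = w := by
  simpa [h] using gate_spec X x w

theorem len_gate (X : Sym2 V) (x : V) (w : S.G X) :
    S.len X w = S.len X (S.gate X x w) + (S.ex X x w).natAbs := by
  conv_lhs => rw [← gate_spec X x w]
  exact gate_min X x w _

theorem len_gate_lt (h : S.ex X x w ≠ 0) : S.len X (S.gate X x w) < S.len X w := by
  have := len_gate X x w; omega

theorem ex_one (X : Sym2 V) (x : V) : S.ex X x 1 = 0 := by
  have := len_gate X x (1 : S.G X)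
  rw [S.len_one] at this; omega

theorem min_one (X : Sym2 V) (x : V) : S.LMin X x 1 := ex_eq_zero_iff.1 (ex_one X x)

theorem ex_zpow (X : Sym2 V) (x : V) (n : ℤ) : S.ex X x (S.gen X x ^ n) = n := by
  simpa using ex_of_min (min_one (S := S) X x) n

theorem gate_zpow (X : Sym2 V) (x : V) (n : ℤ) : S.gate X x (S.gen X x ^ n) = 1 := by
  simpa using gate_of_min (min_one (S := S) X x) n

theorem exists_ex_ne (hX : ¬ X.IsDiag) (hw : w ≠ 1) : ∃ x ∈ X, S.ex X x w ≠ 0 := by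
  by_contra! h
  exact hw (S.eq_one X w hX fun x hx => ex_eq_zero_iff.1 (h x hx))

theorem ex_sep (hX : ¬ X.IsDiag) (hx : x ∈ X) (hy : y ∈ X) (hxy : x ≠ y) (hn : n ≠ 0) (i : ℤ) :
    S.ex X y (S.gen X x ^ n * S.gen X y ^ i) = 0 :=
  ex_eq_zero_iff.2 (S.sep X x y hX hx hy hxy n i hn)

theorem ex_zpow_of_ne (hX : ¬ X.IsDiag) (hx : x ∈ X) (hy : y ∈ X) (hxy : x ≠ y) (n : ℤ) :
    S.ex X y (S.gen X x ^ n) = 0 := by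
  by_cases hn : n = 0
  · subst hn; simpa using ex_one X y
  · simpa using ex_sep (S := S) hX hx hy hxy hn 0

theorem ne_one_of_ex (h : S.ex X x w ≠ 0) : w ≠ 1 := by
  rintro rfl; exact h (ex_one X x)

theorem ex_other (hX : ¬ X.IsDiag) (hy : y ∈ X) (hx : x ∈ X) (hxy : x ≠ y)
    (hw : w ≠ 1) (h : S.ex X x w = 0) : S.ex X y w ≠ 0 := by
  obtain ⟨z, hz, hz'⟩ := exists_ex_ne hX hw
  have hXe := (Sym2.mem_and_mem_iff hxy).1 ⟨hx, hy⟩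
  subst hXe
  rcases Sym2.mem_iff.1 hz with rfl | rfl
  · exact absurd h hz'
  · exact hz'

theorem not_two (hX : ¬ X.IsDiag) (h : ¬ S.Two X w) (hx : x ∈ X) (hx' : S.ex X x w ≠ 0)
    (hy : y ∈ X) (hxy : x ≠ y) : S.ex X y w = 0 := by
  by_contra hy'
  apply h
  intro z hz
  have hXe := (Sym2.mem_and_mem_iff hxy).1 ⟨hx, hy⟩
  subst hXe
  rcases Sym2.mem_iff.1 hz with rfl | rfl
  · exact hx'
  · exact hy'

theorem Two.ne_one (h : S.Two X w) : w ≠ 1 :=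
  ne_one_of_ex (h X.out.1 X.out_fst_mem)

/-- If both letters of `X` are first letters of `w`, then `w = y ^ l * x ^ i * w₁` with
`w₁ ≠ 1` and nonzero exponents. -/
theorem Two.gate_gate (hX : ¬ X.IsDiag) (h : S.Two X w) (hx : x ∈ X) (hy : y ∈ X)
    (hxy : x ≠ y) : S.ex X y w ≠ 0 ∧ S.ex X y (S.gate X y w) = 0 ∧
      S.ex X x (S.gate X y w) ≠ 0 ∧ S.gate X x (S.gate X y w) ≠ 1 := by
  have h0 : S.ex X y (S.gate X y w) = 0 := ex_eq_zero_iff.2 (gate_min X y w)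
  have hne : S.gate X x (S.gate X y w) ≠ 1 := by
    intro h1
    have e1 := gate_spec X x (S.gate X y w)
    rw [h1, mul_one] at e1
    have e2 := gate_spec X y w
    rw [← e1] at e2
    apply h x hx
    rw [← e2]
    exact ex_sep hX hy hx hxy.symm (h y hy) _
  have h1 : S.gate X y w ≠ 1 := by
    intro h1
    apply hne
    rw [h1]
    exact gate_of_ex_eq_zero (ex_one X x)
  exact ⟨h y hy, h0, ex_other hX hx hy hxy.symm h1 h0, hne⟩

end LocalSystem

namespace LocalSystem

variable {V : Type*} {A : Type*} [Group A] {a : V → A}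

/-- Formal normal forms. -/
inductive Pt (S : LocalSystem V A a) where
  | base : Pt S
  | push (p : Pt S) (x : V) (n : ℤ) : Pt S
  | merge (r : Pt S) (X : Sym2 V) (v : S.G X) : Pt S

variable {S : LocalSystem V A a}

namespace Pt

/-- The possible first letters. -/
def Dm : Pt S → V → Prop
  | base, _ => False
  | push _ x _, y => y = x
  | merge _ X _, y => y ∈ X

/-- The element of `A` represented by a normal form. -/
def ev : Pt S → A
  | base => 1
  | push p x n => a x ^ n * ev p
  | merge r X v => S.j X v * ev r

/-- The length of a normal form. -/
def lenPt : Pt S → ℕ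
  | base => 0
  | push p _ n => n.natAbs + lenPt p
  | merge r X v => S.len X v + lenPt r

open Classical in
noncomputable def starAux (r : Pt S) (f : V → ℤ → Pt S) (X : Sym2 V) (w : S.G X) : Pt S :=
  if w = 1 then r
  else if S.Two X w then merge r X w
  else if h : ∃ x ∈ X, S.ex X x w ≠ 0 then
    if S.gate X h.choose w = 1 then f h.choose (S.ex X h.choose w)
    else push (starAux r f X (S.gate X h.choose w)) h.choose (S.ex X h.choose w)
  else r
termination_by S.len X w
decreasing_by exact len_gate_lt h.choose_spec.2

open Classical in
noncomputable def mulAux (p : Pt S) (t : (X : Sym2 V) → Pt S × S.G X) (x : V) (n : ℤ) : Pt S :=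
  match p with
  | push _ y _ =>
    if y ≠ x ∧ S.Two s(x, y) (S.gen s(x, y) x ^ n * (t s(x, y)).2) then
      merge (t s(x, y)).1 s(x, y) (S.gen s(x, y) x ^ n * (t s(x, y)).2)
    else push p x n
  | _ => push p x n

open Classical in
noncomputable def tail : Pt S → (X : Sym2 V) → Pt S × S.G X
  | base, _ => (base, 1)
  | push p x n, X =>
    if x ∈ X then ((tail p X).1, S.gen X x ^ n * (tail p X).2) else (push p x n, 1)
  | merge r Y v, X =>
    if h : Y = X then (r, h ▸ v)
    else if h : ∃ y ∈ X, y ∈ Y then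
      (starAux r (mulAux r (tail r)) Y (S.gate Y h.choose v),
        S.gen X h.choose ^ S.ex Y h.choose v)
    else (merge r Y v, 1)

/-- Left multiplication of a normal form by `x ^ n`. -/
noncomputable def mul (p : Pt S) (x : V) (n : ℤ) : Pt S := mulAux p (tail p) x n

/-- Left multiplication of a normal form by an element of the local group at `X`. -/
noncomputable def star (r : Pt S) (X : Sym2 V) (w : S.G X) : Pt S := starAux r (mul r) X w

/-- `x` is not a first letter of `p`, for each `x ∈ X`. -/
def Free (r : Pt S) (X : Sym2 V) : Prop := ∀ x ∈ X, ¬ Dm r x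

def Valid : Pt S → Prop
  | base => True
  | push p x n => Valid p ∧ ¬ Dm p x ∧ n ≠ 0 ∧ mul p x n = push p x n
  | merge r X v => Valid r ∧ ¬ X.IsDiag ∧ Free r X ∧ S.Two X v

variable {X Y : Sym2 V} {x y : V} {n : ℤ} {p q r : Pt S} {w w₀ : S.G X}

theorem tail_base (X : Sym2 V) : tail (base : Pt S) X = (base, 1) := by simp [tail]

theorem tail_push_mem (hx : x ∈ X) :
    tail (push p x n) X = ((tail p X).1, S.gen X x ^ n * (tail p X).2) := by simp [tail, hx]

theorem tail_push_notMem (hx : x ∉ X) : tail (push p x n) X = (push p x n, 1) := by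
  simp [tail, hx]

theorem tail_merge_self : tail (merge r X w) X = (r, w) := by simp [tail]

theorem tail_merge_disjoint (v : S.G Y) (hne : Y ≠ X) (h : ∀ y ∈ X, y ∉ Y) :
    tail (merge r Y v) X = (merge r Y v, 1) := by
  have : ¬ ∃ y ∈ X, y ∈ Y := by rintro ⟨y, h1, h2⟩; exact h y h1 h2
  simp [tail, hne, this]

theorem tail_merge_inter (v : S.G Y) (hne : Y ≠ X) (hyX : y ∈ X) (hyY : y ∈ Y) :
    tail (merge r Y v) X = (star r Y (S.gate Y y v), S.gen X y ^ S.ex Y y v) := by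
  have h : ∃ y ∈ X, y ∈ Y := ⟨y, hyX, hyY⟩
  have hc : h.choose = y := by
    by_contra hc
    exact hne (((Sym2.mem_and_mem_iff hc).1 ⟨h.choose_spec.2, hyY⟩).trans
      ((Sym2.mem_and_mem_iff hc).1 ⟨h.choose_spec.1, hyX⟩).symm)
  rw [tail, dif_neg hne, dif_pos h, hc]
  rfl

theorem tail_of_free (h : Free r X) : tail r X = (r, 1) := by
  cases r with
  | base => exact tail_base X
  | push p x n => exact tail_push_notMem fun hx => h x hx rfl
  | merge r Y v =>
    apply tail_merge_disjoint
    · rintro rfl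
      exact h _ Y.out_fst_mem Y.out_fst_mem
    · exact fun y hy hy' => h y hy hy'

theorem star_one : star r X 1 = r := by
  rw [star, starAux]; simp

theorem star_two (h : S.Two X w) : star r X w = merge r X w := by
  rw [star, starAux, if_neg h.ne_one, if_pos h]

open Classical in
theorem star_step (hX : ¬ X.IsDiag) (h : ¬ S.Two X w) (hx : x ∈ X) (hx' : S.ex X x w ≠ 0) :
    star r X w = if S.gate X x w = 1 then mul r x (S.ex X x w)
      else push (star r X (S.gate X x w)) x (S.ex X x w) := by
  have hex : ∃ x ∈ X, S.ex X x w ≠ 0 := ⟨x, hx, hx'⟩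
  have hc : hex.choose = x := by
    by_contra hc
    exact hex.choose_spec.2 (not_two hX h hx hx' hex.choose_spec.1 (Ne.symm hc))
  rw [star, starAux, if_neg (ne_one_of_ex hx'), if_neg h, dif_pos hex, hc]
  rfl

theorem star_zpow (hX : ¬ X.IsDiag) (hx : x ∈ X) (hn : n ≠ 0) :
    star r X (S.gen X x ^ n) = mul r x n := by
  have h : ¬ S.Two X (S.gen X x ^ n) := by
    intro h
    have := Sym2.other_mem hx
    refine h _ this (ex_zpow_of_ne hX hx this ?_ n)
    exact (Sym2.other_ne hX hx).symm
  rw [star_step hX h hx (by rwa [ex_zpow]), gate_zpow, if_pos rfl, ex_zpow]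

theorem star_push (hX : ¬ X.IsDiag) (h : ¬ S.Two X (S.gen X x ^ n * w₀)) (hx : x ∈ X)
    (h0 : S.ex X x w₀ = 0) (hn : n ≠ 0) (h1 : w₀ ≠ 1) :
    star r X (S.gen X x ^ n * w₀) = push (star r X w₀) x n := by
  have hm := ex_eq_zero_iff.1 h0
  rw [star_step hX h hx (by rwa [ex_of_min hm]), gate_of_min hm, if_neg h1, ex_of_min hm]

theorem mul_eq_push_of_dm (hq : tail q X = (r, w₀)) (hx : x ∈ X) (hy : y ∈ X) (hxy : x ≠ y)
    (hd : Dm q y) (h : ¬ S.Two X (S.gen X x ^ n * w₀)) : mul q x n = push q x n := by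
  have hXe := (Sym2.mem_and_mem_iff hxy).1 ⟨hx, hy⟩
  subst hXe
  cases q with
  | base => rfl
  | merge => rfl
  | push p z e =>
    obtain rfl : y = z := hd
    rw [mul, mulAux, hq, if_neg (fun h' => h h'.2)]

theorem mul_eq_merge {e : ℤ} (hq : tail (push p y e) X = (r, w₀)) (hx : x ∈ X) (hy : y ∈ X)
    (hxy : x ≠ y) (h : S.Two X (S.gen X x ^ n * w₀)) :
    mul (push p y e) x n = merge r X (S.gen X x ^ n * w₀) := by
  have hXe := (Sym2.mem_and_mem_iff hxy).1 ⟨hx, hy⟩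
  subst hXe
  rw [mul, mulAux, hq, if_pos ⟨hxy.symm, h⟩]

theorem mul_cases (q : Pt S) (x : V) (n : ℤ) : mul q x n = push q x n ∨
    ∃ p y e, q = push p y e ∧ x ≠ y ∧
      S.Two s(x, y) (S.gen s(x, y) x ^ n * (tail q s(x, y)).2) ∧
      mul q x n = merge (tail q s(x, y)).1 s(x, y)
        (S.gen s(x, y) x ^ n * (tail q s(x, y)).2) := by
  cases q with
  | base => exact Or.inl rfl
  | merge => exact Or.inl rfl
  | push p y e =>
    by_cases h : y ≠ x ∧ S.Two s(x, y) (S.gen s(x, y) x ^ n * (tail (push p y e) s(x, y)).2)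
    · refine Or.inr ⟨p, y, e, rfl, h.1.symm, h.2, ?_⟩
      rw [mul, mulAux, if_pos h]
    · left
      rw [mul, mulAux, if_neg h]

/-- The main invariant: splitting off the `X`-part of `h` and multiplying it back. -/
structure Splits (h : Pt S) (X : Sym2 V) : Prop where
  valid : Valid (tail h X).1
  free : Free (tail h X).1 X
  star_eq : star (tail h X).1 X (tail h X).2 = h
  dm : ∀ x ∈ X, Dm h x ↔ S.ex X x (tail h X).2 ≠ 0
  ev_eq : ev h = S.j X (tail h X).2 * ev (tail h X).1
  len_eq : lenPt h = S.len X (tail h X).2 + lenPt (tail h X).1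

structure StarSpec (r : Pt S) (X : Sym2 V) (w : S.G X) : Prop where
  valid : Valid (star r X w)
  tail_eq : tail (star r X w) X = (r, w)
  dm : ∀ x ∈ X, Dm (star r X w) x ↔ S.ex X x w ≠ 0
  ev_eq : ev (star r X w) = S.j X w * ev r
  len_eq : lenPt (star r X w) = S.len X w + lenPt r

theorem starSpec_zpow (hr : Valid r) (hs : ∀ X : Sym2 V, ¬ X.IsDiag → Splits r X)
    (hX : ¬ X.IsDiag) (hf : Free r X) (hx : x ∈ X) (hn : n ≠ 0) :
    StarSpec r X (S.gen X x ^ n) := by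
  have hstar := star_zpow (r := r) hX hx hn
  have hdm : ∀ x' ∈ X, S.ex X x' (S.gen X x ^ n) ≠ 0 ↔ x' = x := by
    intro x' hx'
    by_cases h : x' = x
    · subst h; simpa [ex_zpow] using hn
    · simp [h, ex_zpow_of_ne hX hx hx' (Ne.symm h)]
  have hlen : S.len X (S.gen X x ^ n) = n.natAbs := by
    simpa [S.len_one] using min_one (S := S) X x n
  rcases mul_cases r x n with h | ⟨p, z, e, hrp, hxz, htwo, h⟩
  · refine ⟨?_, ?_, ?_, ?_, ?_⟩ <;> rw [hstar, h]
    · exact ⟨hr, hf x hx, hn, h⟩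
    · rw [tail_push_mem hx, tail_of_free hf, mul_one]
    · intro x' hx'
      rw [hdm x' hx']; rfl
    · rw [ev, map_zpow, S.j_gen X x hX hx]
    · rw [lenPt, hlen]
  · have hz : z ∉ X := fun hz => hf z hz (by rw [hrp]; rfl)
    have hZ : ¬ (s(x, z)).IsDiag := by simpa using hxz
    have hne : s(x, z) ≠ X := by rintro rfl; exact hz (Sym2.mem_mk_right _ _)
    have hxZ := Sym2.mem_mk_left x z
    have sp := hs _ hZ
    set Z := s(x, z)
    have hmin : S.ex Z x (tail r Z).2 = 0 := by
      by_contra h'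
      exact hf x hx ((sp.dm x hxZ).2 h')
    have hm := ex_eq_zero_iff.1 hmin
    refine ⟨?_, ?_, ?_, ?_, ?_⟩ <;> rw [hstar, h]
    · exact ⟨sp.valid, hZ, sp.free, htwo⟩
    · rw [tail_merge_inter _ hne hx hxZ, gate_of_min hm, ex_of_min hm, sp.star_eq]
    · intro x' hx'
      rw [hdm x' hx']
      constructor
      · intro h'
        rcases Sym2.mem_iff.1 h' with h' | h'
        · exact h'
        · exact absurd (h' ▸ hx') hz
      · rintro rfl
        exact hxZ
    · rw [ev, map_mul, map_zpow, map_zpow, S.j_gen X x hX hx, S.j_gen Z x hZ hxZ, mul_assoc,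
        ← sp.ev_eq]
    · rw [lenPt, hm n, hlen, sp.len_eq]; omega

theorem starSpec (hr : Valid r) (hs : ∀ X : Sym2 V, ¬ X.IsDiag → Splits r X)
    (hX : ¬ X.IsDiag) (hf : Free r X) (w : S.G X) : StarSpec r X w := by
  induction hl : S.len X w using Nat.strong_induction_on generalizing w with
  | _ l ih =>
  by_cases h1 : w = 1
  · subst h1
    refine ⟨?_, ?_, ?_, ?_, ?_⟩ <;> rw [star_one]
    · exact hr
    · exact tail_of_free hf
    · intro x hx
      simp [ex_one, hf x hx]
    · simp
    · simp [S.len_one]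
  by_cases h2 : S.Two X w
  · refine ⟨?_, ?_, ?_, ?_, ?_⟩ <;> rw [star_two h2]
    · exact ⟨hr, hX, hf, h2⟩
    · exact tail_merge_self
    · intro x hx
      simp [Dm, hx, h2 x hx]
    · rfl
    · rfl
  obtain ⟨x, hx, hx'⟩ := exists_ex_ne hX h1
  have hw := gate_spec X x w
  have hmin := gate_min X x w
  have hl' := len_gate_lt hx'
  set n := S.ex X x w
  set w₀ := S.gate X x w
  have h0 := ex_eq_zero_iff.2 hmin
  by_cases h3 : w₀ = 1
  · rw [h3, mul_one] at hw
    rw [← hw]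
    exact starSpec_zpow hr hs hX hf hx hx'
  have sp := ih _ (hl ▸ hl') w₀ rfl
  have hxy : x ≠ Sym2.Mem.other hx := (Sym2.other_ne hX hx).symm
  have hy := Sym2.other_mem hx
  set y := Sym2.Mem.other hx
  have hey : S.ex X y w₀ ≠ 0 := ex_other hX hy hx hxy h3 h0
  have hyz : S.ex X y w = 0 := not_two hX h2 hx hx' hy hxy
  have hdm : ∀ x' ∈ X, S.ex X x' w ≠ 0 ↔ x' = x := by
    intro x₁ hx₁
    by_cases h : x₁ = x
    · subst h; simpa using hx'
    · have : x₁ = y := by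
        have hXe := (Sym2.mem_and_mem_iff hxy).1 ⟨hx, hy⟩
        rw [hXe] at hx₁
        rcases Sym2.mem_iff.1 hx₁ with h' | h'
        · exact absurd h' h
        · exact h'
      subst this
      simp [h, hyz]
  have h2' := h2
  rw [← hw] at h2'
  have hst : star r X w = push (star r X w₀) x n := by
    conv_lhs => rw [← hw]
    exact star_push hX h2' hx h0 hx' h3
  refine ⟨?_, ?_, ?_, ?_, ?_⟩ <;> rw [hst]
  · refine ⟨sp.valid, ?_, hx', ?_⟩
    · rw [sp.dm x hx]; simp [h0]
    · exact mul_eq_push_of_dm sp.tail_eq hx hy hxy ((sp.dm y hy).2 hey) h2'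
  · rw [tail_push_mem hx, sp.tail_eq, hw]
  · intro x' hx'
    rw [hdm x' hx']; rfl
  · conv_rhs => rw [← hw]
    rw [ev, map_mul, map_zpow, S.j_gen X x hX hx, mul_assoc, sp.ev_eq]
  · conv_rhs => rw [← hw]
    rw [lenPt, hmin n, sp.len_eq]; omega

theorem splits_of_free (hr : Valid r) (hf : Free r X) : Splits r X := by
  have ht := tail_of_free hf
  refine ⟨?_, ?_, ?_, ?_, ?_, ?_⟩ <;> rw [ht]
  · exact hr
  · exact hf
  · exact star_one
  · intro x hx
    simp [ex_one, hf x hx]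
  · simp
  · simp [S.len_one]

theorem splits_push (hp : ∀ X : Sym2 V, ¬ X.IsDiag → Splits p X) (hv : Valid (push p x n))
    (hX : ¬ X.IsDiag) : Splits (push p x n) X := by
  by_cases hx : x ∈ X
  swap
  · exact splits_of_free hv fun x' hx' h => hx (h ▸ hx')
  obtain ⟨hvp, hd, hn, hmul⟩ := hv
  have sp := hp X hX
  have ht := tail_push_mem (p := p) (n := n) hx
  have hpt : tail p X = ((tail p X).1, (tail p X).2) := rfl
  set t := (tail p X).1
  set w₀ := (tail p X).2
  have h0 : S.ex X x w₀ = 0 := by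
    by_contra h
    exact hd ((sp.dm x hx).2 h)
  have hm := ex_eq_zero_iff.1 h0
  have hxy : x ≠ Sym2.Mem.other hx := (Sym2.other_ne hX hx).symm
  have hy := Sym2.other_mem hx
  have hother : ∀ x' ∈ X, x' ≠ x → x' = Sym2.Mem.other hx := by
    intro x' hx' hne
    have hXe := (Sym2.mem_and_mem_iff hxy).1 ⟨hx, hy⟩
    rw [hXe] at hx'
    exact (Sym2.mem_iff.1 hx').resolve_left hne
  set y := Sym2.Mem.other hx
  have h2 : ¬ S.Two X (S.gen X x ^ n * w₀) := by
    intro h2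
    by_cases h1 : w₀ = 1
    · rw [h1, mul_one] at h2
      exact h2 y hy (ex_zpow_of_ne hX hx hy hxy n)
    have hdy : Dm p y := (sp.dm y hy).2 (ex_other hX hy hx hxy h1 h0)
    cases p with
    | base => exact hdy
    | push p z e =>
      obtain rfl : y = z := hdy
      rw [mul_eq_merge hpt hx hy hxy h2] at hmul
      cases hmul
    | merge r Y v =>
      have hne : Y ≠ X := by
        rintro rfl; exact hd hx
      have hw : w₀ = S.gen X y ^ S.ex Y y v := by
        have := tail_merge_inter (r := r) v hne hy hdy
        exact congrArg Prod.snd this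
      rw [hw] at h2
      exact h2 y hy (ex_sep hX hx hy hxy hn _)
  have hdm : ∀ x' ∈ X, S.ex X x' (S.gen X x ^ n * w₀) ≠ 0 ↔ x' = x := by
    intro x₁ hx₁
    by_cases h : x₁ = x
    · subst h; simpa [ex_of_min hm] using hn
    · rw [not_two hX h2 hx (by rwa [ex_of_min hm]) hx₁ (Ne.symm h)]
      simp [h]
  refine ⟨?_, ?_, ?_, ?_, ?_, ?_⟩ <;> rw [ht]
  · exact sp.valid
  · exact sp.free
  · change star t X (S.gen X x ^ n * w₀) = _
    by_cases h1 : w₀ = 1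
    · have hst := sp.star_eq
      change star t X w₀ = p at hst
      rw [h1, star_one] at hst
      rw [h1, mul_one, star_zpow hX hx hn, hst, hmul]
    · rw [star_push hX h2 hx h0 hn h1, sp.star_eq]
  · intro x' hx'
    rw [hdm x' hx']; rfl
  · rw [ev, map_mul, map_zpow, S.j_gen X x hX hx, mul_assoc, sp.ev_eq]
  · change lenPt (push p x n) = S.len X (S.gen X x ^ n * w₀) + lenPt t
    have hl : lenPt p = S.len X w₀ + lenPt t := sp.len_eq
    rw [lenPt, hm n, hl]; omega

theorem splits_merge (v : S.G Y) (hr : ∀ X : Sym2 V, ¬ X.IsDiag → Splits r X)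
    (hv : Valid (merge r Y v)) (hX : ¬ X.IsDiag) : Splits (merge r Y v) X := by
  by_cases hYX : Y = X
  · subst hYX
    obtain ⟨hvr, hY, hf, h2⟩ := hv
    have ht : tail (merge r Y v) Y = (r, v) := tail_merge_self
    refine ⟨?_, ?_, ?_, ?_, ?_, ?_⟩ <;> rw [ht]
    · exact hvr
    · exact hf
    · exact star_two h2
    · intro x hx
      simp [Dm, hx, h2 x hx]
    · rfl
    · rfl
  by_cases hdis : ∀ y ∈ X, y ∉ Y
  · exact splits_of_free hv hdis
  push Not at hdis
  obtain ⟨y, hyX, hyY⟩ := hdis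
  obtain ⟨hvr, hY, hf, h2⟩ := hv
  have ht := tail_merge_inter (r := r) v hYX hyX hyY
  have hyz : y ≠ Sym2.Mem.other hyY := (Sym2.other_ne hY hyY).symm
  have hz := Sym2.other_mem hyY
  set z := Sym2.Mem.other hyY
  obtain ⟨hj, h0, hi, h1⟩ := h2.gate_gate hY hz hyY hyz.symm
  have hvs := gate_spec Y y v
  have hvm := gate_min Y y v
  set w₀ := S.gate Y y v
  have hws := gate_spec Y z w₀
  have hwm := gate_min Y z w₀
  set i := S.ex Y y v
  set w₁ := S.gate Y z w₀
  have sp := starSpec hvr hr hY hf w₀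
  have hn2 : ¬ S.Two Y w₀ := fun h => h y hyY h0
  have hq : star r Y w₀ = push (star r Y w₁) z (S.ex Y z w₀) := by
    rw [← hws] at hn2
    conv_lhs => rw [← hws]
    exact star_push hY hn2 hz (ex_eq_zero_iff.2 hwm) hi h1
  have hzX : z ∉ X := fun h => hYX (((Sym2.mem_and_mem_iff hyz).1 ⟨hyY, hz⟩).trans
      ((Sym2.mem_and_mem_iff hyz).1 ⟨hyX, h⟩).symm)
  have hXY : ∀ x ∈ X, x ∈ Y ↔ x = y := by
    intro x hx
    constructor
    · intro hxY
      by_contra hne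
      exact hYX (((Sym2.mem_and_mem_iff hne).1 ⟨hxY, hyY⟩).trans
        ((Sym2.mem_and_mem_iff hne).1 ⟨hx, hyX⟩).symm)
    · rintro rfl; exact hyY
  refine ⟨?_, ?_, ?_, ?_, ?_, ?_⟩ <;> rw [ht]
  · exact sp.valid
  · intro x hx hd
    change Dm (star r Y w₀) x at hd
    rw [hq] at hd
    exact hzX ((show x = z from hd) ▸ hx)
  · change star (star r Y w₀) X (S.gen X y ^ i) = _
    rw [star_zpow hX hyX hj]
    have htl := sp.tail_eq
    rw [hq] at htl ⊢
    rw [mul_eq_merge htl hyY hz hyz (by rwa [hvs]), hvs]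
  · intro x hx
    change x ∈ Y ↔ S.ex X x (S.gen X y ^ i) ≠ 0
    rw [hXY x hx]
    by_cases h : x = y
    · subst h; simpa [ex_zpow] using hj
    · simp [h, ex_zpow_of_ne hX hyX hx (Ne.symm h)]
  · change ev (merge r Y v) = S.j X (S.gen X y ^ i) * ev (star r Y w₀)
    rw [sp.ev_eq, ← mul_assoc, map_zpow, S.j_gen X y hX hyX, ← S.j_gen Y y hY hyY, ← map_zpow,
      ← map_mul, hvs, ev]
  · change lenPt (merge r Y v) = S.len X (S.gen X y ^ i) + lenPt (star r Y w₀)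
    have h3 := min_one (S := S) X y i
    rw [mul_one, S.len_one] at h3
    have h4 := hvm i
    rw [hvs] at h4
    rw [sp.len_eq, h3, lenPt, h4]; omega

theorem splits (h : Pt S) (hv : Valid h) (X : Sym2 V) (hX : ¬ X.IsDiag) : Splits h X := by
  induction h generalizing X with
  | base => exact splits_of_free hv fun x _ h => h
  | push p x n ih => exact splits_push (ih hv.1) hv hX
  | merge r Y v ih => exact splits_merge v (ih hv.1) hv hX

theorem star_spec (hr : Valid r) (hX : ¬ X.IsDiag) (hf : Free r X) (w : S.G X) :
    StarSpec r X w :=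
  starSpec hr (splits r hr) hX hf w

end Pt
end LocalSystem

namespace LocalSystem
namespace Pt

variable {V : Type*} {A : Type*} [Group A] {a : V → A} {S : LocalSystem V A a}
variable {X Y : Sym2 V} {x y : V} {n : ℤ} {h p q r : Pt S} {w w₀ : S.G X}

open Classical in
/-- Left multiplication of a normal form by `x ^ n`, with `n = 0` allowed. -/
noncomputable def mulf (q : Pt S) (x : V) (n : ℤ) : Pt S := if n = 0 then q else mul q x n

theorem mulf_zero : mulf q x 0 = q := if_pos rfl

theorem mulf_of_ne (hn : n ≠ 0) : mulf q x n = mul q x n := if_neg hn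

theorem mulf_star (hX : ¬ X.IsDiag) (hr : Valid r) (hf : Free r X) (hx : x ∈ X)
    (h0 : S.ex X x w₀ = 0) (n : ℤ) :
    mulf (star r X w₀) x n = star r X (S.gen X x ^ n * w₀) := by
  by_cases hn : n = 0
  · subst hn; simp [mulf_zero]
  rw [mulf_of_ne hn]
  by_cases h1 : w₀ = 1
  · rw [h1, mul_one, star_one, star_zpow hX hx hn]
  have hxy : x ≠ Sym2.Mem.other hx := (Sym2.other_ne hX hx).symm
  have hy := Sym2.other_mem hx
  set y := Sym2.Mem.other hx
  have hey : S.ex X y w₀ ≠ 0 := ex_other hX hy hx hxy h1 h0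
  have sp := star_spec hr hX hf w₀
  by_cases h2 : S.Two X (S.gen X x ^ n * w₀)
  · have hws := gate_spec X y w₀
    have hwm := gate_min X y w₀
    set i := S.ex X y w₀
    set w₁ := S.gate X y w₀
    have hw₁ : w₁ ≠ 1 := by
      intro h
      rw [h, mul_one] at hws
      rw [← hws] at h2
      exact h2 y hy (ex_sep hX hx hy hxy hn i)
    have hn2 : ¬ S.Two X (S.gen X y ^ i * w₁) := fun h => h x hx (by rwa [hws])
    have hq := star_push (r := r) hX hn2 hy (ex_eq_zero_iff.2 hwm) hey hw₁
    rw [hws] at hq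
    have ht := sp.tail_eq
    rw [star_two h2]
    rw [hq] at ht ⊢
    exact mul_eq_merge ht hx hy hxy h2
  · rw [star_push hX h2 hx h0 hn h1]
    exact mul_eq_push_of_dm sp.tail_eq hx hy hxy ((sp.dm y hy).2 hey) h2

open Classical in
/-- The decomposition `h = x ^ n * q` with `x` not a first letter of `q`. -/
noncomputable def lineOf (h : Pt S) (x : V) : Pt S × ℤ :=
  match h with
  | base => (base, 0)
  | push p y n => if y = x then (p, n) else (push p y n, 0)
  | merge r Y v => if x ∈ Y then (star r Y (S.gate Y x v), S.ex Y x v) else (merge r Y v, 0)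

theorem lineOf_of_not_dm (h : ¬ Dm q x) : lineOf q x = (q, 0) := by
  cases q with
  | base => rfl
  | push p y n => exact if_neg fun e => h e.symm
  | merge r Y v => exact if_neg h

theorem lineOf_push : lineOf (push p x n) x = (p, n) := if_pos rfl

theorem lineOf_merge (v : S.G Y) (hx : x ∈ Y) :
    lineOf (merge r Y v) x = (star r Y (S.gate Y x v), S.ex Y x v) := if_pos hx

structure MulSpec (q : Pt S) (x : V) (n : ℤ) : Prop where
  valid : Valid (mulf q x n)
  lineOf_eq : lineOf (mulf q x n) x = (q, n)
  ev_eq : ev (mulf q x n) = a x ^ n * ev q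
  len_eq : lenPt (mulf q x n) = n.natAbs + lenPt q

theorem mulSpec (hq : Valid q) (hd : ¬ Dm q x) (n : ℤ) : MulSpec q x n := by
  by_cases hn : n = 0
  · subst hn
    refine ⟨?_, ?_, ?_, ?_⟩ <;> rw [mulf_zero]
    · exact hq
    · exact lineOf_of_not_dm hd
    · simp
    · simp
  rcases mul_cases q x n with h | ⟨p, z, e, -, hxz, h2, h⟩
  · refine ⟨?_, ?_, ?_, ?_⟩ <;> rw [mulf_of_ne hn, h]
    · exact ⟨hq, hd, hn, h⟩
    · exact lineOf_push
    · rfl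
    · rfl
  · have hZ : ¬ (s(x, z)).IsDiag := by simpa using hxz
    have hxZ := Sym2.mem_mk_left x z
    have sp := splits q hq _ hZ
    set Z := s(x, z)
    have hmin : S.ex Z x (tail q Z).2 = 0 := by
      by_contra h'
      exact hd ((sp.dm x hxZ).2 h')
    have hm := ex_eq_zero_iff.1 hmin
    refine ⟨?_, ?_, ?_, ?_⟩ <;> rw [mulf_of_ne hn, h]
    · exact ⟨sp.valid, hZ, sp.free, h2⟩
    · rw [lineOf_merge _ hxZ, gate_of_min hm, ex_of_min hm, sp.star_eq]
    · rw [ev, map_mul, map_zpow, S.j_gen Z x hZ hxZ, mul_assoc, ← sp.ev_eq]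
    · rw [lenPt, hm n, sp.len_eq]; omega

theorem lineOf_spec (hv : Valid h) (x : V) :
    Valid (lineOf h x).1 ∧ ¬ Dm (lineOf h x).1 x ∧ mulf (lineOf h x).1 x (lineOf h x).2 = h := by
  by_cases hd : Dm h x
  swap
  · rw [lineOf_of_not_dm hd]; exact ⟨hv, hd, mulf_zero⟩
  cases h with
  | base => exact hd.elim
  | push p y n =>
    obtain rfl : x = y := hd
    rw [lineOf_push]
    exact ⟨hv.1, hv.2.1, by rw [mulf_of_ne hv.2.2.1]; exact hv.2.2.2⟩
  | merge r Y v =>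
    rw [lineOf_merge v hd]
    obtain ⟨hr, hY, hf, h2⟩ := hv
    have sp := star_spec hr hY hf (S.gate Y x v)
    have h0 := ex_eq_zero_iff.2 (gate_min Y x v)
    refine ⟨sp.valid, ?_, ?_⟩
    · rw [sp.dm x hd]; simp [h0]
    · change mulf (star r Y (S.gate Y x v)) x (S.ex Y x v) = _
      rw [mulf_star hY hr hf hd h0, gate_spec, star_two h2]

/-- The action of `x ^ k` on normal forms. -/
noncomputable def act (x : V) (k : ℤ) (h : Pt S) : Pt S :=
  mulf (lineOf h x).1 x (k + (lineOf h x).2)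

theorem act_mulf (hq : Valid q) (hd : ¬ Dm q x) (k n : ℤ) :
    act x k (mulf q x n) = mulf q x (k + n) := by
  rw [act, (mulSpec hq hd n).lineOf_eq]

theorem exists_mulf (hv : Valid h) (x : V) :
    ∃ q n, Valid q ∧ ¬ Dm q x ∧ h = mulf q x n :=
  have := lineOf_spec hv x
  ⟨_, _, this.1, this.2.1, this.2.2.symm⟩

theorem act_valid (hv : Valid h) (x : V) (k : ℤ) : Valid (act x k h) := by
  obtain ⟨q, n, hq, hd, rfl⟩ := exists_mulf hv x
  rw [act_mulf hq hd]
  exact (mulSpec hq hd _).valid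

theorem act_add (hv : Valid h) (x : V) (k l : ℤ) : act x (k + l) h = act x k (act x l h) := by
  obtain ⟨q, n, hq, hd, rfl⟩ := exists_mulf hv x
  rw [act_mulf hq hd, act_mulf hq hd, act_mulf hq hd, add_assoc]

theorem act_zero (hv : Valid h) (x : V) : act x 0 h = h := by
  obtain ⟨q, n, hq, hd, rfl⟩ := exists_mulf hv x
  rw [act_mulf hq hd, zero_add]

theorem ev_act (hv : Valid h) (x : V) (k : ℤ) : ev (act x k h) = a x ^ k * ev h := by
  obtain ⟨q, n, hq, hd, rfl⟩ := exists_mulf hv x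
  rw [act_mulf hq hd, (mulSpec hq hd _).ev_eq, (mulSpec hq hd _).ev_eq, zpow_add, mul_assoc]

theorem act_star (hX : ¬ X.IsDiag) (hr : Valid r) (hf : Free r X) (hx : x ∈ X) (k : ℤ)
    (w : S.G X) : act x k (star r X w) = star r X (S.gen X x ^ k * w) := by
  have h0 := ex_eq_zero_iff.2 (gate_min X x w)
  have sp := star_spec hr hX hf (S.gate X x w)
  have hd : ¬ Dm (star r X (S.gate X x w)) x := by rw [sp.dm x hx]; simp [h0]
  conv_lhs => rw [← gate_spec X x w, ← mulf_star hX hr hf hx h0, act_mulf sp.valid hd,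
    mulf_star hX hr hf hx h0, zpow_add, mul_assoc, gate_spec]

end Pt

variable {V : Type*} {A : Type*} [Group A] {a : V → A} (S : LocalSystem V A a)

/-- The set of normal forms. -/
abbrev NF := {h : Pt S // h.Valid}

variable {S}

/-- The action of a generator on normal forms. -/
noncomputable def genPerm (x : V) : Equiv.Perm S.NF where
  toFun h := ⟨h.1.act x 1, Pt.act_valid h.2 x 1⟩
  invFun h := ⟨h.1.act x (-1), Pt.act_valid h.2 x (-1)⟩
  left_inv h := Subtype.ext (by
    change Pt.act x (-1) (Pt.act x 1 h.1) = h.1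
    rw [← Pt.act_add h.2, neg_add_cancel, Pt.act_zero h.2])
  right_inv h := Subtype.ext (by
    change Pt.act x 1 (Pt.act x (-1) h.1) = h.1
    rw [← Pt.act_add h.2, add_neg_cancel, Pt.act_zero h.2])

theorem genPerm_zpow (x : V) (k : ℤ) (h : S.NF) :
    ((genPerm x ^ k) h).1 = h.1.act x k := by
  induction k generalizing h with
  | zero => simp [Pt.act_zero h.2]
  | succ k ih =>
    rw [zpow_add_one, Equiv.Perm.mul_apply, ih, Pt.act_add h.2]; rfl
  | pred k ih =>
    rw [zpow_sub_one, Equiv.Perm.mul_apply, ih, sub_eq_add_neg, Pt.act_add h.2]; rfl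

/-- The action of a local group on normal forms. -/
noncomputable def localHom (X : Sym2 V) (hX : ¬ X.IsDiag) : S.G X →* Equiv.Perm S.NF :=
  letI : MulAction (S.G X) S.NF :=
    { smul u h := ⟨Pt.star (Pt.tail h.1 X).1 X (u * (Pt.tail h.1 X).2), by
        have sp := Pt.splits h.1 h.2 X hX
        exact (Pt.star_spec sp.valid hX sp.free _).valid⟩
      one_smul h := Subtype.ext (by
        change Pt.star (Pt.tail h.1 X).1 X (1 * (Pt.tail h.1 X).2) = h.1
        rw [one_mul, (Pt.splits h.1 h.2 X hX).star_eq])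
      mul_smul u v h := Subtype.ext (by
        have sp := Pt.splits h.1 h.2 X hX
        change Pt.star _ X _ = Pt.star (Pt.tail (Pt.star _ X _) X).1 X
          (u * (Pt.tail (Pt.star _ X _) X).2)
        rw [(Pt.star_spec sp.valid hX sp.free _).tail_eq, mul_assoc]) }
  MulAction.toPermHom (S.G X) S.NF

theorem localHom_apply {X : Sym2 V} (hX : ¬ X.IsDiag) (u : S.G X) (h : S.NF) :
    (localHom X hX u h).1 = Pt.star (Pt.tail h.1 X).1 X (u * (Pt.tail h.1 X).2) := rfl

theorem localHom_gen {X : Sym2 V} (hX : ¬ X.IsDiag) {x : V} (hx : x ∈ X) :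
    localHom (S := S) X hX (S.gen X x) = genPerm x := by
  ext1 h
  apply Subtype.ext
  have sp := Pt.splits h.1 h.2 X hX
  rw [localHom_apply]
  change _ = Pt.act x 1 h.1
  conv_rhs => rw [← sp.star_eq]
  rw [Pt.act_star hX sp.valid sp.free hx, zpow_one]

theorem hom_ext_gen {X : Sym2 V} (hX : ¬ X.IsDiag) {B : Type*} [Group B] {φ ψ : S.G X →* B}
    (h : ∀ x ∈ X, φ (S.gen X x) = ψ (S.gen X x)) : φ = ψ := by
  ext w
  induction hl : S.len X w using Nat.strong_induction_on generalizing w with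
  | _ l ih =>
  by_cases h1 : w = 1
  · simp [h1]
  obtain ⟨x, hx, hx'⟩ := exists_ex_ne hX h1
  rw [← gate_spec X x w, map_mul, map_mul, map_zpow, map_zpow, h x hx,
    ih _ (hl ▸ len_gate_lt hx') _ rfl]

end LocalSystem

open LocalSystem in
/-- If `A` has the universal property of the colimit of the local groups, it carries a length
function compatible with those of the local groups. -/
theorem LocalSystem.exists_length {V A : Type*} [Group A] {a : V → A}
    (S : LocalSystem V A a) (φ : A →* Equiv.Perm S.NF) (hφ : ∀ x, φ (a x) = genPerm x)
    (hgen : Subgroup.closure (Set.range a) = ⊤) :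
    ∃ ℓ : A → ℕ, ℓ 1 = 0 ∧
      (∀ g, (∀ x, ∀ k : ℤ, ℓ (a x ^ k * g) = ℓ g + k.natAbs) → g = 1) ∧
      (∀ x g, ∃ (p : A) (n : ℤ), g = a x ^ n * p ∧ ∀ k : ℤ, ℓ (a x ^ k * p) = ℓ p + k.natAbs) ∧
      (∀ X : Sym2 V, ¬ X.IsDiag → ∀ g, ∃ (r : A) (w : S.G X), g = S.j X w * r ∧
        ∀ w', ℓ (S.j X w' * r) = ℓ r + S.len X w') := by
  have hpow : ∀ x (k : ℤ) (h : S.NF), (φ (a x ^ k) h).1 = h.1.act x k := by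
    intro x k h
    rw [map_zpow, hφ, genPerm_zpow]
  have hloc : ∀ X (hX : ¬ X.IsDiag) (w : S.G X), φ (S.j X w) = localHom X hX w := by
    intro X hX w
    have : φ.comp (S.j X) = localHom X hX := hom_ext_gen hX fun x hx => by
      rw [localHom_gen hX hx, MonoidHom.comp_apply, S.j_gen X x hX hx, hφ]
    exact DFunLike.congr_fun this w
  have hev : ∀ g (h : S.NF), Pt.ev (φ g h).1 = g * Pt.ev h.1 := by
    intro g
    have hg : g ∈ Subgroup.closure (Set.range a) := hgen ▸ Subgroup.mem_top g
    induction hg using Subgroup.closure_induction with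
    | mem g hg =>
      obtain ⟨x, rfl⟩ := hg
      intro h
      have := hpow x 1 h
      rw [zpow_one] at this
      rw [this, Pt.ev_act h.2, zpow_one]
    | one => simp
    | mul g g' _ _ ih ih' => intro h; rw [map_mul, Equiv.Perm.mul_apply, ih, ih', mul_assoc]
    | inv g _ ih =>
      intro h
      have := ih (φ g⁻¹ h)
      rw [← Equiv.Perm.mul_apply, ← map_mul, mul_inv_cancel, map_one,
        Equiv.Perm.one_apply] at this
      rw [this, inv_mul_cancel_left]
  let b : S.NF := ⟨Pt.base, trivial⟩
  have hsurj : ∀ h : Pt S, ∀ hv : h.Valid, φ (Pt.ev h) b = ⟨h, hv⟩ := by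
    have key : ∀ h : Pt S, ∀ hv : h.Valid, ∃ g, φ g b = ⟨h, hv⟩ := by
      intro h
      induction h with
      | base => exact fun _ => ⟨1, by rw [map_one]; rfl⟩
      | push p x n ih =>
        intro hv
        obtain ⟨hv₁, hv₂, hv₃, hv₄⟩ := id hv
        obtain ⟨g, hg⟩ := ih hv₁
        refine ⟨a x ^ n * g, Subtype.ext ?_⟩
        rw [map_mul, Equiv.Perm.mul_apply, hg, hpow]
        have := Pt.act_mulf hv₁ hv₂ n 0
        rw [Pt.mulf_zero, add_zero, Pt.mulf_of_ne hv₃, hv₄] at this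
        exact this
      | merge r X v ih =>
        intro hv
        obtain ⟨hv₁, hv₂, hv₃, hv₄⟩ := id hv
        obtain ⟨g, hg⟩ := ih hv₁
        refine ⟨S.j X v * g, Subtype.ext ?_⟩
        rw [map_mul, Equiv.Perm.mul_apply, hg, hloc X hv₂, localHom_apply,
          Pt.tail_of_free hv₃, mul_one, Pt.star_two hv₄]
    intro h hv
    obtain ⟨g, hg⟩ := key h hv
    have := hev g b
    rw [hg] at this
    have hb : Pt.ev b.1 = 1 := rfl
    rw [hb, mul_one] at this
    change Pt.ev h = g at this
    rw [this, hg]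
  have hevb : ∀ g, Pt.ev (φ g b).1 = g := by
    intro g
    have := hev g b
    rwa [show Pt.ev b.1 = 1 from rfl, mul_one] at this
  have hline : ∀ x (q : Pt S) (k : ℤ), q.Valid → ¬ q.Dm x →
      (φ (a x ^ k * q.ev) b).1 = q.mulf x k := by
    intro x q k hq hd
    rw [map_mul, Equiv.Perm.mul_apply, hsurj q hq, hpow]
    have := Pt.act_mulf hq hd k 0
    rwa [Pt.mulf_zero, add_zero] at this
  have hb : ∀ q : Pt S, q.Valid → (φ q.ev b).1 = q := fun q hq => by rw [hsurj q hq]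
  refine ⟨fun g => Pt.lenPt (φ g b).1, ?_, ?_, ?_, ?_⟩
  · simp only [map_one, Equiv.Perm.one_apply]; rfl
  · intro g hmin
    have hd : ∀ x, ¬ Pt.Dm (φ g b).1 x := by
      intro x hx
      obtain ⟨q, n, hq, hd, he⟩ := Pt.exists_mulf (φ g b).2 x
      have hn : n ≠ 0 := by
        rintro rfl
        rw [Pt.mulf_zero] at he
        exact hd (he ▸ hx)
      have h1 := hmin x (-n)
      have h2 : g = a x ^ n * q.ev := by
        rw [← hevb g, he, (Pt.mulSpec hq hd n).ev_eq]
      have h3 : a x ^ (-n) * g = q.ev := by rw [h2, ← mul_assoc, ← zpow_add]; simp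
      simp only [] at h1
      rw [h3, hb q hq, he, (Pt.mulSpec hq hd n).len_eq] at h1
      omega
    rw [← hevb g]
    revert hd
    generalize hh : φ g b = h
    obtain ⟨h, hv⟩ := h
    intro hd
    cases h with
    | base => rfl
    | push p x n => exact absurd rfl (hd x)
    | merge r X v => exact absurd X.out_fst_mem (hd _)
  · intro x g
    obtain ⟨q, n, hq, hd, he⟩ := Pt.exists_mulf (φ g b).2 x
    refine ⟨q.ev, n, ?_, ?_⟩
    · rw [← hevb g, he, (Pt.mulSpec hq hd n).ev_eq]
    · intro k
      simp only []
      rw [hline x q k hq hd, hb q hq, (Pt.mulSpec hq hd k).len_eq, add_comm]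
  · intro X hX g
    have sp := Pt.splits (φ g b).1 (φ g b).2 X hX
    refine ⟨Pt.ev (Pt.tail (φ g b).1 X).1, (Pt.tail (φ g b).1 X).2, ?_, ?_⟩
    · rw [← sp.ev_eq, hevb]
    · intro w
      simp only []
      rw [map_mul, Equiv.Perm.mul_apply, hsurj _ sp.valid, hloc X hX, localHom_apply,
        Pt.tail_of_free sp.free, mul_one, (Pt.star_spec sp.valid hX sp.free w).len_eq, add_comm]

namespace LocalSystem

variable {V : Type*} {A : Type*} [Group A] {a : V → A}

/-- A length function on `A` compatible with the local length functions. -/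
structure IsLength (S : LocalSystem V A a) (ℓ : A → ℕ) : Prop where
  one : ℓ 1 = 0
  eq_one : ∀ g, (∀ x, ∀ k : ℤ, ℓ (a x ^ k * g) = ℓ g + k.natAbs) → g = 1
  gate : ∀ x g, ∃ (p : A) (n : ℤ), g = a x ^ n * p ∧
    ∀ k : ℤ, ℓ (a x ^ k * p) = ℓ p + k.natAbs
  block : ∀ X : Sym2 V, ¬ X.IsDiag → ∀ g, ∃ (r : A) (w : S.G X), g = S.j X w * r ∧
    ∀ w', ℓ (S.j X w' * r) = ℓ r + S.len X w'

/-- `x` is not a first letter of `g`. -/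
def NotFirst (a : V → A) (ℓ : A → ℕ) (x : V) (g : A) : Prop :=
  ∀ k : ℤ, ℓ (a x ^ k * g) = ℓ g + k.natAbs

/-- `u` is a product of `n` letters from `Λ`. -/
inductive Rep (a : V → A) (Λ : Set V) : ℕ → A → Prop
  | one : Rep a Λ 0 1
  | cons {n : ℕ} {u : A} (c : V) (ε : ℤ) : c ∈ Λ → ε.natAbs = 1 → Rep a Λ n u →
      Rep a Λ (n + 1) (a c ^ ε * u)

open Classical in
/-- The word length with respect to the letters in `Λ`. -/
noncomputable def relLen (a : V → A) (Λ : Set V) (u : A) : ℕ :=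
  sInf {n | Rep a Λ n u}

theorem rep_mem {Λ : Set V} {n : ℕ} {u : A} (h : Rep a Λ n u) :
    u ∈ Subgroup.closure (a '' Λ) := by
  induction h with
  | one => exact one_mem _
  | cons c ε hc _ _ ih =>
    exact mul_mem (zpow_mem (Subgroup.subset_closure (Set.mem_image_of_mem a hc)) ε) ih

theorem exists_rep {Λ : Set V} {u : A} (hu : u ∈ Subgroup.closure (a '' Λ)) :
    ∃ n, Rep a Λ n u := by
  induction hu using Subgroup.closure_induction_left with
  | one => exact ⟨0, Rep.one⟩
  | mul_left x hx y _ ih =>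
    obtain ⟨c, hc, rfl⟩ := hx
    obtain ⟨n, hn⟩ := ih
    refine ⟨n + 1, ?_⟩
    simpa using Rep.cons c 1 hc rfl hn
  | inv_mul_cancel x hx y _ ih =>
    obtain ⟨c, hc, rfl⟩ := hx
    obtain ⟨n, hn⟩ := ih
    refine ⟨n + 1, ?_⟩
    simpa using Rep.cons c (-1) hc rfl hn

theorem rep_relLen {Λ : Set V} {u : A} (hu : u ∈ Subgroup.closure (a '' Λ)) :
    Rep a Λ (relLen a Λ u) u :=
  Nat.sInf_mem (s := {n | Rep a Λ n u}) (exists_rep hu)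

theorem relLen_le {Λ : Set V} {n : ℕ} {u : A} (h : Rep a Λ n u) : relLen a Λ u ≤ n :=
  Nat.sInf_le h

theorem letter_mem {Λ : Set V} {c : V} (hc : c ∈ Λ) (ε : ℤ) :
    a c ^ ε ∈ Subgroup.closure (a '' Λ) :=
  zpow_mem (Subgroup.subset_closure (Set.mem_image_of_mem a hc)) ε

theorem relLen_letter_mul_le {Λ : Set V} {u : A} (hu : u ∈ Subgroup.closure (a '' Λ)) {c : V}
    (hc : c ∈ Λ) {ε : ℤ} (hε : ε.natAbs = 1) :
    relLen a Λ (a c ^ ε * u) ≤ relLen a Λ u + 1 :=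
  relLen_le (Rep.cons c ε hc hε (rep_relLen hu))

theorem le_relLen_letter_mul {Λ : Set V} {u : A} (hu : u ∈ Subgroup.closure (a '' Λ)) {c : V}
    (hc : c ∈ Λ) {ε : ℤ} (hε : ε.natAbs = 1) :
    relLen a Λ u ≤ relLen a Λ (a c ^ ε * u) + 1 := by
  have := relLen_letter_mul_le (mul_mem (letter_mem hc ε) hu) hc (ε := -ε) (by omega)
  rwa [← mul_assoc, ← zpow_add, neg_add_cancel, zpow_zero, one_mul] at this

theorem exists_letter {Λ : Set V} {u : A} (hu : u ∈ Subgroup.closure (a '' Λ)) {n : ℕ}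
    (hn : relLen a Λ u = n + 1) : ∃ c ∈ Λ, ∃ (ε : ℤ) (v : A), ε.natAbs = 1 ∧
      v ∈ Subgroup.closure (a '' Λ) ∧ relLen a Λ v = n ∧ u = a c ^ ε * v := by
  have h := rep_relLen hu
  rw [hn] at h
  cases h with
  | @cons _ v c ε hc hε hv =>
    refine ⟨c, hc, ε, v, hε, rep_mem hv, ?_, rfl⟩
    have h1 := relLen_le hv
    have h2 := relLen_letter_mul_le (rep_mem hv) hc hε
    omega

namespace IsLength

variable {S : LocalSystem V A a} {ℓ : A → ℕ} {X : Sym2 V} {x y z : V} {g h p q r : A}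

theorem gate_unique (hp : NotFirst a ℓ x p) (hq : NotFirst a ℓ x q) {m n : ℤ}
    (h : a x ^ m * p = a x ^ n * q) : m = n ∧ p = q := by
  have e1 : p = a x ^ (n - m) * q := by
    rw [sub_eq_neg_add, zpow_add, mul_assoc, ← h, zpow_neg, inv_mul_cancel_left]
  have e2 : q = a x ^ (m - n) * p := by
    rw [e1, ← mul_assoc, ← zpow_add]; simp
  have l1 := hq (n - m)
  have l2 := hp (m - n)
  rw [← e1] at l1
  rw [← e2] at l2
  have : m = n := by omega
  refine ⟨this, ?_⟩
  rw [e1, this]; simp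

theorem first_of_gate (hp : NotFirst a ℓ x p) {n : ℤ} (hn : n ≠ 0) :
    ¬ NotFirst a ℓ x (a x ^ n * p) := by
  intro h
  have := gate_unique hp h (m := n) (n := 0) (by simp)
  exact hn this.1

theorem len_step (H : IsLength S ℓ) (x : V) (g : A) {ε : ℤ} (hε : ε.natAbs = 1) :
    ℓ (a x ^ ε * g) = ℓ g + 1 ∨
      (ℓ (a x ^ ε * g) + 1 = ℓ g ∧ ℓ (a x ^ (-ε) * g) = ℓ g + 1) := by
  obtain ⟨p, n, rfl, hp⟩ := H.gate x g
  rw [← mul_assoc, ← mul_assoc, ← zpow_add, ← zpow_add, hp, hp, hp]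
  omega

theorem exists_down (H : IsLength S ℓ) (h : ¬ NotFirst a ℓ x g) :
    ∃ ε : ℤ, ε.natAbs = 1 ∧ ℓ (a x ^ ε * g) + 1 = ℓ g := by
  obtain ⟨p, n, rfl, hp⟩ := H.gate x g
  have hn : n ≠ 0 := by
    rintro rfl
    apply h
    rw [zpow_zero, one_mul]
    exact hp
  refine ⟨-n.sign, by rw [Int.natAbs_neg, Int.natAbs_sign_of_ne_zero hn], ?_⟩
  rw [← mul_assoc, ← zpow_add, hp, hp]
  rcases lt_or_gt_of_ne hn with h | h
  · rw [Int.sign_eq_neg_one_of_neg h]; omega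
  · rw [Int.sign_eq_one_of_pos h]; omega

theorem first_of_down {n : ℤ} (h : ℓ (a x ^ n * g) < ℓ g) : ¬ NotFirst a ℓ x g := by
  intro h'
  have := h' n
  omega

theorem notFirst_of_le (H : IsLength S ℓ) (h : ∀ n : ℤ, ℓ g ≤ ℓ (a x ^ n * g)) :
    NotFirst a ℓ x g := by
  by_contra h'
  obtain ⟨ε, -, hε⟩ := H.exists_down h'
  have := h ε
  omega

theorem notFirst_one (H : IsLength S ℓ) (x : V) : NotFirst a ℓ x 1 :=
  H.notFirst_of_le fun n => by rw [H.one]; exact Nat.zero_le _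

theorem exists_first (H : IsLength S ℓ) (hg : g ≠ 1) :
    ∃ x, ∃ ε : ℤ, ε.natAbs = 1 ∧ ℓ (a x ^ ε * g) + 1 = ℓ g := by
  by_contra! hx
  refine hg (H.eq_one g fun x => ?_)
  by_contra h
  obtain ⟨ε, h1, h2⟩ := H.exists_down h
  exact hx x ε h1 h2

theorem len_mul_le (H : IsLength S ℓ) (g h : A) : ℓ (g * h) ≤ ℓ g + ℓ h := by
  induction hl : ℓ g generalizing g with
  | zero =>
    have : g = 1 := by
      by_contra hg
      obtain ⟨x, ε, -, h2⟩ := H.exists_first hg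
      omega
    simp [this]
  | succ n ih =>
    have hg : g ≠ 1 := by
      rintro rfl
      rw [H.one] at hl; omega
    obtain ⟨x, ε, h1, h2⟩ := H.exists_first hg
    have h3 := ih (a x ^ ε * g) (by omega)
    rw [mul_assoc] at h3
    rcases H.len_step x (g * h) h1 with h4 | h4 <;> omega

theorem len_letter (H : IsLength S ℓ) (x : V) {ε : ℤ} (hε : ε.natAbs = 1) : ℓ (a x ^ ε) = 1 := by
  have := H.notFirst_one x ε
  rwa [mul_one, H.one, hε] at this

theorem len_inv_le (H : IsLength S ℓ) (g : A) : ℓ g⁻¹ ≤ ℓ g := by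
  induction hl : ℓ g generalizing g with
  | zero =>
    have : g = 1 := by
      by_contra hg
      obtain ⟨x, ε, -, h2⟩ := H.exists_first hg
      omega
    simp [this, H.one]
  | succ n ih =>
    have hg : g ≠ 1 := by
      rintro rfl
      rw [H.one] at hl; omega
    obtain ⟨x, ε, h1, h2⟩ := H.exists_first hg
    have h3 := ih (a x ^ ε * g) (by omega)
    have h4 := H.len_mul_le (a x ^ ε * g)⁻¹ (a x ^ ε)
    rw [H.len_letter x h1, mul_inv_rev, inv_mul_cancel_right] at h4
    rw [mul_inv_rev] at h3
    omega

theorem len_inv (H : IsLength S ℓ) (g : A) : ℓ g⁻¹ = ℓ g :=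
  le_antisymm (H.len_inv_le g) (by simpa using H.len_inv_le g⁻¹)

theorem eq_one_of_len (H : IsLength S ℓ) (hg : ℓ g = 0) : g = 1 := by
  by_contra h
  obtain ⟨x, ε, -, h2⟩ := H.exists_first h
  omega

theorem notFirst_block (hX : ¬ X.IsDiag) (hx : x ∈ X)
    (hr : ∀ w, ℓ (S.j X w * r) = ℓ r + S.len X w) (w : S.G X) :
    NotFirst a ℓ x (S.j X w * r) ↔ S.ex X x w = 0 := by
  rw [ex_eq_zero_iff]
  refine forall_congr' fun k => ?_
  rw [← mul_assoc, ← S.j_gen X x hX hx, ← map_zpow, ← map_mul, hr, hr]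
  omega

theorem block_of_notFirst (H : IsLength S ℓ) (hX : ¬ X.IsDiag)
    (hg : ∀ x ∈ X, NotFirst a ℓ x g) (w : S.G X) : ℓ (S.j X w * g) = ℓ g + S.len X w := by
  obtain ⟨r, w₀, rfl, hr⟩ := H.block X hX g
  have : w₀ = 1 := by
    by_contra h
    obtain ⟨x, hx, hx'⟩ := exists_ex_ne hX h
    exact hx' ((notFirst_block hX hx hr w₀).1 (hg x hx))
  subst this
  simp only [map_one, one_mul]
  exact hr w

theorem len_local (H : IsLength S ℓ) (hX : ¬ X.IsDiag) (w : S.G X) :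
    ℓ (S.j X w) = S.len X w := by
  have := H.block_of_notFirst hX (fun x _ => H.notFirst_one x) w
  rwa [mul_one, H.one, zero_add] at this

theorem notFirst_letter_mul (H : IsLength S ℓ) (hxy : x ≠ y) (hx : NotFirst a ℓ x g)
    (hy : NotFirst a ℓ y g) (n : ℤ) : NotFirst a ℓ y (a x ^ n * g) := by
  have hX : ¬ (s(x, y)).IsDiag := by simpa using hxy
  have hb := H.block_of_notFirst (g := g) hX (by
    intro z hz
    rcases Sym2.mem_iff.1 hz with rfl | rfl <;> assumption)
  have hxX := Sym2.mem_mk_left x y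
  have hyX := Sym2.mem_mk_right x y
  rw [← S.j_gen _ x hX hxX, ← map_zpow, notFirst_block hX hyX hb]
  exact ex_zpow_of_ne hX hxX hyX hxy n

theorem no_third_first (H : IsLength S ℓ) (h : A) {x y z : V} (hxy : x ≠ y) (hyz : y ≠ z)
    (hxz : x ≠ z) {p : A} {i : ℤ} (hp : NotFirst a ℓ x p) (hh : h = a x ^ i * p)
    (hx : ¬ NotFirst a ℓ x h) (hy : ¬ NotFirst a ℓ y h) : NotFirst a ℓ z p := by
  induction hl : ℓ h using Nat.strong_induction_on generalizing h x y z p i with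
  | _ l ih =>
  by_contra hz
  have hX : ¬ (s(x, y)).IsDiag := by simpa using hxy
  have hxX := Sym2.mem_mk_left x y
  have hyX := Sym2.mem_mk_right x y
  have hmem : ∀ t ∈ s(x, y), t = x ∨ t = y := fun t => Sym2.mem_iff.1
  generalize s(x, y) = X at hX hxX hyX hmem
  obtain ⟨r, w, hw, hr⟩ := H.block X hX h
  have h2 : S.Two X w := by
    intro t ht
    rcases hmem t ht with rfl | rfl
    · rwa [Ne, ← notFirst_block hX ht hr w, ← hw]
    · rwa [Ne, ← notFirst_block hX ht hr w, ← hw]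
  obtain ⟨h3, h4, h5, h6⟩ := h2.gate_gate hX hyX hxX hxy.symm
  have hw' := gate_spec X x w
  have hw'' := gate_spec X y (S.gate X x w)
  have hm := gate_min X y (S.gate X x w)
  set w' := S.gate X x w
  set w'' := S.gate X y w'
  have hpw : p = S.j X w' * r := by
    have := gate_unique hp ((notFirst_block hX hxX hr w').2 h4) (m := i) (n := S.ex X x w) (by
      rw [← hh, hw, ← mul_assoc, ← S.j_gen X x hX hxX, ← map_zpow, ← map_mul, hw'])
    exact this.2
  have hlt : ℓ p < l := by
    have hi : i ≠ 0 := by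
      rintro rfl
      apply hx
      simpa [hh] using hp
    have := hp i
    rw [← hh] at this
    omega
  have hx'' : ¬ NotFirst a ℓ x (S.j X w'' * r) := by
    rw [notFirst_block hX hxX hr]
    exact ex_other hX hxX hyX hxy.symm h6 (ex_eq_zero_iff.2 hm)
  refine hx'' (ih _ hlt p hyz hxz.symm hxy.symm ((notFirst_block hX hyX hr w'').2
    (ex_eq_zero_iff.2 hm)) (i := S.ex X y w') ?_ ?_ hz rfl)
  · rw [hpw, ← mul_assoc, ← S.j_gen X y hX hyX, ← map_zpow, ← map_mul, hw'']
  · rw [hpw, notFirst_block hX hyX hr]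
    exact h5

theorem j_mem {Λ : Set V} (hX : ¬ X.IsDiag) (hΛ : ∀ x ∈ X, x ∈ Λ) (w : S.G X) :
    S.j X w ∈ Subgroup.closure (a '' Λ) := by
  induction hl : S.len X w using Nat.strong_induction_on generalizing w with
  | _ l ih =>
  by_cases h1 : w = 1
  · simp [h1, one_mem]
  obtain ⟨x, hx, hx'⟩ := exists_ex_ne hX h1
  rw [← gate_spec X x w, map_mul, map_zpow, S.j_gen X x hX hx]
  exact mul_mem (letter_mem (hΛ x hx) _) (ih _ (hl ▸ len_gate_lt hx') _ rfl)

theorem relLen_j_mul_le (H : IsLength S ℓ) {Λ : Set V} (hX : ¬ X.IsDiag) (hΛ : ∀ x ∈ X, x ∈ Λ)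
    {t : A} (ht : t ∈ Subgroup.closure (a '' Λ)) (w : S.G X) :
    relLen a Λ (S.j X w * t) ≤ S.len X w + relLen a Λ t := by
  induction hl : S.len X w generalizing w with
  | zero =>
    have h := H.len_local hX w
    rw [hl] at h
    simp [H.eq_one_of_len h]
  | succ n ih =>
    have h1 : w ≠ 1 := by
      rintro rfl
      rw [S.len_one] at hl; omega
    obtain ⟨x, hx, hx'⟩ := exists_ex_ne hX h1
    obtain ⟨ε, hε, hε'⟩ := H.exists_down (x := x) (g := S.j X w) (by
      rw [← mul_one (S.j X w), notFirst_block hX hx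
        (H.block_of_notFirst hX fun x _ => H.notFirst_one x)]
      exact hx')
    have he : a x ^ ε * S.j X w = S.j X (S.gen X x ^ ε * w) := by
      rw [map_mul, map_zpow, S.j_gen X x hX hx]
    rw [he, H.len_local hX, H.len_local hX] at hε'
    have h2 := ih (S.gen X x ^ ε * w) (by omega)
    rw [← he, mul_assoc] at h2
    have h3 := le_relLen_letter_mul (mul_mem (j_mem hX hΛ w) ht) (hΛ x hx) hε
    omega

/-- Multiplying an element with no first letter in `Λ` by an element of the parabolic subgroup
on `Λ` adds lengths. -/
theorem len_mul_relLen (H : IsLength S ℓ) {Λ : Set V} {k : A} (hk : ∀ c ∈ Λ, NotFirst a ℓ c k)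
    {u : A} (hu : u ∈ Subgroup.closure (a '' Λ)) : ℓ (u * k) = ℓ k + relLen a Λ u := by
  induction hl : relLen a Λ u using Nat.strong_induction_on generalizing u with
  | _ l ih =>
  cases l with
  | zero =>
    have := rep_relLen hu
    rw [hl] at this
    cases this
    simp
  | succ n =>
  obtain ⟨c, hc, ε, u', hε, hu', hl', rfl⟩ := exists_letter hu hl
  have h1 := ih n (by omega) hu' hl'
  rw [mul_assoc]
  rcases H.len_step c (u' * k) hε with h2 | ⟨h2, h2'⟩
  · omega
  exfalso
  cases n with
  | zero =>
    have := rep_relLen hu'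
    rw [hl'] at this
    cases this
    rw [one_mul, hk c hc] at h2
    omega
  | succ m =>
  obtain ⟨d, hd, δ, u'', hδ, hu'', hl'', rfl⟩ := exists_letter hu' hl'
  have h3 := ih m (by omega) hu'' hl''
  by_cases hcd : c = d
  · subst hcd
    by_cases hεδ : ε = -δ
    · subst hεδ
      rw [← mul_assoc, ← zpow_add, neg_add_cancel, zpow_zero, one_mul] at hl
      omega
    · have : -ε = -δ := by omega
      rw [this, mul_assoc, ← mul_assoc, ← zpow_add, neg_add_cancel, zpow_zero, one_mul, h3,
        ← mul_assoc, h1] at h2'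
      omega
  have hX : ¬ (s(c, d)).IsDiag := by simpa using hcd
  have hcX := Sym2.mem_mk_left c d
  have hdX := Sym2.mem_mk_right c d
  have hΛ : ∀ x ∈ s(c, d), x ∈ Λ := by
    intro x hx
    rcases Sym2.mem_iff.1 hx with rfl | rfl <;> assumption
  set X := s(c, d)
  set u' := a d ^ δ * u''
  let P : ℕ → Prop := fun s => ∃ (w : S.G X) (t : A), t ∈ Subgroup.closure (a '' Λ) ∧
    u' = S.j X w * t ∧ s = relLen a Λ t ∧ relLen a Λ t + S.len X w = m + 1
  have hP : P m := by
    refine ⟨S.gen X d ^ δ, u'', hu'', ?_, hl''.symm, ?_⟩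
    · rw [map_zpow, S.j_gen X d hX hdX]
    · rw [hl'', ← H.len_local hX, map_zpow, S.j_gen X d hX hdX, H.len_letter d hδ]
  classical
  have hex : ∃ s, P s := ⟨m, hP⟩
  have hmin : ∀ s, P s → Nat.find hex ≤ s := fun s hs => Nat.find_min' hex hs
  obtain ⟨w, t, ht, hut, hst, hlt⟩ := Nat.find_spec hex
  rw [hst] at hmin
  have hlm := hmin m hP
  have ht1 := ih (relLen a Λ t) (by omega) ht rfl
  have hfree : ∀ x ∈ X, NotFirst a ℓ x (t * k) := by
    intro x hx
    by_contra hf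
    obtain ⟨η, hη, hη'⟩ := H.exists_down hf
    have h4 := relLen_letter_mul_le ht (hΛ x hx) hη
    have h5 := ih (relLen a Λ (a x ^ η * t)) (by omega) (mul_mem (letter_mem (hΛ x hx) η) ht) rfl
    rw [mul_assoc] at h5
    have h6 : u' = S.j X (w * S.gen X x ^ (-η)) * (a x ^ η * t) := by
      rw [hut, map_mul, map_zpow, S.j_gen X x hX hx]
      simp [mul_assoc]
    have h7 : S.len X (w * S.gen X x ^ (-η)) ≤ S.len X w + 1 := by
      have := H.len_mul_le (S.j X w) (a x ^ (-η))
      rw [H.len_letter x (by omega), H.len_local hX, ← S.j_gen X x hX hx, ← map_zpow, ← map_mul,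
        H.len_local hX] at this
      exact this
    have h8 := H.relLen_j_mul_le hX hΛ (mul_mem (letter_mem (hΛ x hx) η) ht)
      (w * S.gen X x ^ (-η))
    rw [← h6, hl'] at h8
    have h9 := hmin (relLen a Λ (a x ^ η * t))
      ⟨_, _, mul_mem (letter_mem (hΛ x hx) η) ht, h6, rfl, by omega⟩
    omega
  have h4 := H.block_of_notFirst hX hfree (S.gen X c ^ ε * w)
  have h5 := H.relLen_j_mul_le hX hΛ ht (S.gen X c ^ ε * w)
  have h6 : a c ^ ε * u' = S.j X (S.gen X c ^ ε * w) * t := by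
    rw [hut, map_mul, map_zpow, S.j_gen X c hX hcX, mul_assoc]
  rw [← mul_assoc, ← h6, mul_assoc] at h4
  rw [← h6] at h5
  omega

theorem len_eq_relLen (H : IsLength S ℓ) {Λ : Set V} {u : A}
    (hu : u ∈ Subgroup.closure (a '' Λ)) : ℓ u = relLen a Λ u := by
  have := H.len_mul_relLen (fun c _ => H.notFirst_one c) hu
  rwa [mul_one, H.one, zero_add] at this

theorem len_mul_of_notFirst (H : IsLength S ℓ) {Λ : Set V} {k : A}
    (hk : ∀ c ∈ Λ, NotFirst a ℓ c k) {u : A} (hu : u ∈ Subgroup.closure (a '' Λ)) :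
    ℓ (u * k) = ℓ u + ℓ k := by
  rw [H.len_mul_relLen hk hu, H.len_eq_relLen hu, add_comm]

theorem mem_of_closure_le (H : IsLength S ℓ) {Λ Λ' : Set V}
    (hle : Subgroup.closure (a '' Λ) ≤ Subgroup.closure (a '' Λ')) : Λ ⊆ Λ' := by
  intro c hc
  have hm : a c ∈ Subgroup.closure (a '' Λ') :=
    hle (Subgroup.subset_closure (Set.mem_image_of_mem a hc))
  have h1 : ℓ (a c) = 1 := by simpa using H.len_letter c (ε := 1) rfl
  obtain ⟨d, hd, ε, v, hε, hv, hlv, he⟩ := exists_letter hm (n := 0)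
    (by rw [← H.len_eq_relLen hm, h1])
  have hv1 : v = 1 := H.eq_one_of_len (by rw [H.len_eq_relLen hv, hlv])
  by_cases hcd : c = d
  · exact hcd ▸ hd
  have h2 := H.notFirst_letter_mul hcd (H.notFirst_one c) (H.notFirst_one d) 1
  rw [zpow_one, mul_one, he, hv1] at h2
  exact absurd h2 (first_of_gate (H.notFirst_one d) (by omega))

theorem conj_closure (H : IsLength S ℓ) {Λ Λ' : Set V} (hΛ : Λ.Nontrivial) {g : A}
    (hg : ∀ u, u ∈ Subgroup.closure (a '' Λ) ↔ g * u * g⁻¹ ∈ Subgroup.closure (a '' Λ')) :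
    Λ = Λ' ∧ g ∈ Subgroup.closure (a '' Λ) := by
  obtain ⟨u₀, hu₀, hmin⟩ : ∃ u₀ ∈ Subgroup.closure (a '' Λ),
      ∀ u ∈ Subgroup.closure (a '' Λ), ℓ (g * u₀) ≤ ℓ (g * u) := by
    obtain ⟨u₀, hu₀⟩ := WellFounded.has_min (measure fun u => ℓ (g * u)).wf
      (Subgroup.closure (a '' Λ) : Set A) ⟨1, one_mem _⟩
    exact ⟨u₀, hu₀.1, fun u hu => not_lt.1 (hu₀.2 u hu)⟩
  have hk : ∀ u, u ∈ Subgroup.closure (a '' Λ) ↔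
      (g * u₀) * u * (g * u₀)⁻¹ ∈ Subgroup.closure (a '' Λ') := by
    intro u
    have e : (g * u₀) * u * (g * u₀)⁻¹ = g * (u₀ * u * u₀⁻¹) * g⁻¹ := by group
    rw [e, ← hg, Subgroup.mul_mem_cancel_right _ (inv_mem hu₀),
      Subgroup.mul_mem_cancel_left _ hu₀]
  have hkmin : ∀ u ∈ Subgroup.closure (a '' Λ), ℓ (g * u₀) ≤ ℓ ((g * u₀) * u) := by
    intro u hu
    rw [mul_assoc]
    exact hmin _ (mul_mem hu₀ hu)
  suffices hk1 : g * u₀ = 1 by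
    have h1 : g ∈ Subgroup.closure (a '' Λ) := by
      rw [mul_eq_one_iff_eq_inv.1 hk1]
      exact inv_mem hu₀
    refine ⟨?_, h1⟩
    have h2 : Subgroup.closure (a '' Λ) = Subgroup.closure (a '' Λ') := by
      ext u
      rw [hk u, hk1]
      simp
    exact (H.mem_of_closure_le h2.le).antisymm (H.mem_of_closure_le h2.ge)
  generalize g * u₀ = k at hk hkmin
  by_contra hk1
  have hl : ∀ c ∈ Λ', NotFirst a ℓ c k := by
    intro c hc
    refine H.notFirst_of_le fun n => ?_
    have e : a c ^ n * k = k * (k⁻¹ * a c ^ n * k) := by group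
    rw [e]
    refine hkmin _ ((hk _).2 ?_)
    have e' : k * (k⁻¹ * a c ^ n * k) * k⁻¹ = a c ^ n := by group
    rw [e']
    exact letter_mem hc n
  have hr : ∀ c ∈ Λ, NotFirst a ℓ c k⁻¹ := by
    intro c hc
    refine H.notFirst_of_le fun n => ?_
    rw [H.len_inv, ← H.len_inv (a c ^ n * k⁻¹), mul_inv_rev, inv_inv, ← zpow_neg]
    exact hkmin _ (letter_mem hc _)
  obtain ⟨e, ε, hε, he⟩ := H.exists_first (inv_ne_one.2 hk1)
  have heΛ : e ∉ Λ := fun h => first_of_down (n := ε) (by omega) (hr e h)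
  have hfirst : ∀ u ∈ Subgroup.closure (a '' Λ), ¬ NotFirst a ℓ e (u⁻¹ * k⁻¹) := by
    intro u hu
    apply first_of_down (n := ε)
    have hφ := (hk u).1 hu
    have h1 := H.len_mul_of_notFirst hl hφ
    have e1 : a e ^ ε * (u⁻¹ * k⁻¹) = (a e ^ ε * k⁻¹) * (k * u * k⁻¹)⁻¹ := by group
    have e2 : k * u * k⁻¹ * k = (u⁻¹ * k⁻¹)⁻¹ := by group
    have h2 := H.len_mul_le (a e ^ ε * k⁻¹) (k * u * k⁻¹)⁻¹
    rw [e2, H.len_inv] at h1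
    rw [H.len_inv, ← e1] at h2
    rw [H.len_inv] at he
    omega
  obtain ⟨b, hb, c, hc, hbc⟩ := hΛ
  have hbe : b ≠ e := fun h => heΛ (h ▸ hb)
  have hce : c ≠ e := fun h => heΛ (h ▸ hc)
  have hbm : a b ∈ Subgroup.closure (a '' Λ) := by simpa using letter_mem hb 1
  have hcm : a c ∈ Subgroup.closure (a '' Λ) := by simpa using letter_mem hc 1
  have hp : NotFirst a ℓ b (a c ^ (-1 : ℤ) * k⁻¹) :=
    H.notFirst_letter_mul hbc.symm (hr c hc) (hr b hb) _
  have h1 := hfirst _ (mul_mem hcm hbm)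
  have h2 : (a c * a b)⁻¹ * k⁻¹ = a b ^ (-1 : ℤ) * (a c ^ (-1 : ℤ) * k⁻¹) := by group
  rw [h2] at h1
  exact first_of_gate (hr c hc) (by norm_num) (H.no_third_first _ hbe hce.symm hbc hp rfl
    (first_of_gate hp (by norm_num)) h1)

end IsLength
end LocalSystem

/-- The two-generator Artin group with label `m` (free if `m = 0`). -/
abbrev DihedralArtin (m : ℕ) : Type :=
  PresentedGroup ({altProd (FreeGroup.of true) (FreeGroup.of false) m *
    (altProd (FreeGroup.of false) (FreeGroup.of true) m)⁻¹} : Set (FreeGroup Bool))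

theorem map_altProd {M N : Type*} [Monoid M] [Monoid N] (f : M →* N) (a b : M) (n : ℕ) :
    f (altProd a b n) = altProd (f a) (f b) n := by
  induction n generalizing a b with
  | zero => exact map_one f
  | succ n ih => rw [altProd, altProd, map_mul, ih]

/-- Axioms for a length function on a group with two distinguished letters. -/
structure LetterLength {G : Type*} [Group G] (g : Bool → G) (ℓ : G → ℕ) : Prop where
  one : ℓ 1 = 0
  step : ∀ x w, ℓ (g x * w) = ℓ w + 1 ∨ ℓ (g x * w) + 1 = ℓ w
  no_peak : ∀ x w, ℓ w < ℓ (g x * w) ∨ ℓ w < ℓ ((g x)⁻¹ * w)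
  descent : ∀ w, w ≠ 1 → ∃ x, ℓ (g x * w) < ℓ w ∨ ℓ ((g x)⁻¹ * w) < ℓ w
  sep : ∀ x (i j : ℤ), i ≠ 0 →
    ℓ (g x ^ i * g (!x) ^ j) < ℓ (g (!x) * (g x ^ i * g (!x) ^ j)) ∧
    ℓ (g x ^ i * g (!x) ^ j) < ℓ ((g (!x))⁻¹ * (g x ^ i * g (!x) ^ j))

theorem eq_add_natAbs_of_no_peak (f : ℤ → ℕ) (hs : ∀ n, f (n + 1) = f n + 1 ∨ f (n + 1) + 1 = f n)
    (hp : ∀ n, f n < f (n + 1) ∨ f n < f (n - 1)) (n₀ : ℤ) (h₁ : f n₀ < f (n₀ + 1))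
    (h₂ : f n₀ < f (n₀ - 1)) (k : ℤ) : f (k + n₀) = f n₀ + k.natAbs := by
  have up : ∀ n : ℕ, f (n₀ + n) = f n₀ + n ∧ f (n₀ + n + 1) = f n₀ + n + 1 := by
    intro n
    induction n with
    | zero =>
      have := hs n₀
      simp only [Nat.cast_zero, add_zero, true_and]
      omega
    | succ n ih =>
      have e1 := hs (n₀ + n + 1)
      have e2 := hp (n₀ + n + 1)
      rw [add_sub_cancel_right] at e2
      push_cast
      rw [← add_assoc]
      omega
  have down : ∀ n : ℕ, f (n₀ - n) = f n₀ + n ∧ f (n₀ - n - 1) = f n₀ + n + 1 := by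
    intro n
    induction n with
    | zero =>
      have := hs (n₀ - 1)
      rw [sub_add_cancel] at this
      simp only [Nat.cast_zero, sub_zero, add_zero, true_and]
      omega
    | succ n ih =>
      have e1 := hs (n₀ - n - 1 - 1)
      have e2 := hp (n₀ - n - 1)
      rw [sub_add_cancel] at e1 e2
      push_cast
      rw [← sub_sub]
      omega
  rcases Int.natAbs_eq k with h | h
  · rw [h, add_comm, (up _).1, Int.natAbs_natCast]
  · have : k + n₀ = n₀ - (k.natAbs : ℤ) := by omega
    rw [this, (down _).1]

namespace LetterLength

variable {G : Type*} [Group G] {g : Bool → G} {ℓ : G → ℕ}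

theorem eq_add_of_lt (H : LetterLength g ℓ) {x : Bool} {w : G} (h₁ : ℓ w < ℓ (g x * w))
    (h₂ : ℓ w < ℓ ((g x)⁻¹ * w)) (k : ℤ) : ℓ (g x ^ k * w) = ℓ w + k.natAbs := by
  have e : ∀ n : ℤ, g x ^ (n + 1) * w = g x * (g x ^ n * w) := by
    intro n
    rw [add_comm, zpow_add, zpow_one, mul_assoc]
  have e' : ∀ n : ℤ, g x ^ (n - 1) * w = (g x)⁻¹ * (g x ^ n * w) := by
    intro n
    rw [sub_eq_neg_add, zpow_add, zpow_neg_one, mul_assoc]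
  have := eq_add_natAbs_of_no_peak (fun n => ℓ (g x ^ n * w))
    (fun n => by simp only [e]; exact H.step _ _)
    (fun n => by simp only [e, e']; exact H.no_peak _ _) 0
    (by simpa using h₁) (by simpa using h₂) k
  simpa using this

theorem exists_gate (H : LetterLength g ℓ) (x : Bool) (w : G) : ∃ (n : ℤ) (w₀ : G),
    w = g x ^ n * w₀ ∧ ∀ k : ℤ, ℓ (g x ^ k * w₀) = ℓ w₀ + k.natAbs := by
  obtain ⟨n, -, hn⟩ := WellFounded.has_min (measure fun n : ℤ => ℓ (g x ^ n * w)).wf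
    Set.univ ⟨0, trivial⟩
  have hn' : ∀ k : ℤ, ℓ (g x ^ n * w) ≤ ℓ (g x ^ k * w) := fun k => not_lt.1 (hn k trivial)
  refine ⟨-n, g x ^ n * w, by rw [← mul_assoc, ← zpow_add]; simp, H.eq_add_of_lt ?_ ?_⟩
  · have := hn' (1 + n)
    rw [zpow_add, zpow_one, mul_assoc] at this
    rcases H.step x (g x ^ n * w) with h | h <;> omega
  · have := hn' (-1 + n)
    rw [zpow_add, zpow_neg_one, mul_assoc] at this
    have h := H.step x ((g x)⁻¹ * (g x ^ n * w))
    rw [mul_inv_cancel_left] at h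
    omega

theorem eq_one (H : LetterLength g ℓ) {w : G}
    (h : ∀ x, ∀ k : ℤ, ℓ (g x ^ k * w) = ℓ w + k.natAbs) : w = 1 := by
  by_contra hw
  obtain ⟨x, hx | hx⟩ := H.descent w hw
  · have := h x 1
    rw [zpow_one] at this
    omega
  · have := h x (-1)
    rw [zpow_neg_one] at this
    omega

theorem sep_eq (H : LetterLength g ℓ) {x y : Bool} (hxy : x ≠ y) {n : ℤ} (hn : n ≠ 0) (i k : ℤ) :
    ℓ (g y ^ k * (g x ^ n * g y ^ i)) = ℓ (g x ^ n * g y ^ i) + k.natAbs := by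
  obtain rfl : y = !x := by revert hxy; cases x <;> cases y <;> simp
  exact H.eq_add_of_lt (H.sep x n i hn).1 (H.sep x n i hn).2 k

end LetterLength

namespace DihedralArtin

/-- The letter `x`, exchanged with the other letter `n` times. -/
def par (n : ℕ) (x : Bool) : Bool := Nat.rec x (fun _ y => !y) n

theorem par_zero (x : Bool) : par 0 x = x := rfl

theorem par_succ (n : ℕ) (x : Bool) : par (n + 1) x = !par n x := rfl

theorem par_not (n : ℕ) (x : Bool) : par n (!x) = !par n x := by
  induction n with
  | zero => rfl
  | succ n ih => rw [par_succ, par_succ, ih]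

theorem par_add (m n : ℕ) (x : Bool) : par (m + n) x = par m (par n x) := by
  induction m with
  | zero => rw [zero_add, par_zero]
  | succ m ih => rw [Nat.succ_add, par_succ, par_succ, ih]

theorem par_par (n : ℕ) (x : Bool) : par n (par n x) = x := by
  induction n with
  | zero => rfl
  | succ n ih => rw [par_succ, par_succ, par_not, Bool.not_not, ih]

/-- A Garside normal form: the exponent of the Garside element, the first letter, and the
lengths of the proper simple factors. -/
structure St where
  k : ℤ
  l : Bool
  L : List ℕ

/-- Normalize the first letter of a power of the Garside element. -/
def mk' (k : ℤ) (l : Bool) : List ℕ → St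
  | [] => ⟨k, true, []⟩
  | c :: L => ⟨k, l, c :: L⟩

/-- Left multiplication by a letter. -/
def up (m : ℕ) (x : Bool) : St → St
  | ⟨k, _, []⟩ => ⟨k, x, [1]⟩
  | ⟨k, l, c :: L⟩ =>
    if l = x then ⟨k, x, 1 :: c :: L⟩
    else if c + 1 < m then ⟨k, x, (c + 1) :: L⟩
    else mk' (k + 1) (!x) L

/-- Left multiplication by the inverse of a letter. -/
def down (m : ℕ) (x : Bool) : St → St
  | ⟨k, _, []⟩ => ⟨k - 1, !x, [m - 1]⟩
  | ⟨k, l, c :: L⟩ =>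
    if l = x then
      if 2 ≤ c then ⟨k, !x, (c - 1) :: L⟩ else mk' k x L
    else ⟨k - 1, !x, (m - 1) :: c :: L⟩

/-- Well-formed normal forms. -/
def Ok (m : ℕ) (s : St) : Prop := (∀ c ∈ s.L, 1 ≤ c ∧ c < m) ∧ (s.L = [] → s.l = true)

variable {m : ℕ} {s : St} {x : Bool}

theorem ok_mk' {k : ℤ} {l : Bool} {L : List ℕ} (h : ∀ c ∈ L, 1 ≤ c ∧ c < m) :
    Ok m (mk' k l L) := by
  cases L with
  | nil => exact ⟨h, fun _ => rfl⟩
  | cons c L => exact ⟨h, fun h => by cases h⟩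

theorem ok_up (hm : 3 ≤ m) (h : Ok m s) : Ok m (up m x s) := by
  obtain ⟨k, l, L⟩ := s
  cases L with
  | nil => exact ⟨by simp [up]; omega, by simp [up]⟩
  | cons c L =>
    have hc := h.1 c (by simp)
    have hL : ∀ d ∈ L, 1 ≤ d ∧ d < m := fun d hd => h.1 d (by simp [hd])
    rw [up]
    split_ifs
    · refine ⟨?_, by simp⟩
      simp only [List.mem_cons]
      rintro d (rfl | rfl | hd)
      · omega
      · exact hc
      · exact hL d hd
    · refine ⟨?_, by simp⟩
      simp only [List.mem_cons]
      rintro d (rfl | hd)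
      · omega
      · exact hL d hd
    · exact ok_mk' hL

theorem ok_down (hm : 3 ≤ m) (h : Ok m s) : Ok m (down m x s) := by
  obtain ⟨k, l, L⟩ := s
  cases L with
  | nil => exact ⟨by simp [down]; omega, by simp [down]⟩
  | cons c L =>
    have hc := h.1 c (by simp)
    have hL : ∀ d ∈ L, 1 ≤ d ∧ d < m := fun d hd => h.1 d (by simp [hd])
    rw [down]
    split_ifs
    · refine ⟨?_, by simp⟩
      simp only [List.mem_cons]
      rintro d (rfl | hd)
      · omega
      · exact hL d hd
    · exact ok_mk' hL
    · refine ⟨?_, by simp⟩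
      simp only [List.mem_cons]
      rintro d (rfl | rfl | hd)
      · omega
      · exact hc
      · exact hL d hd

theorem down_up (hm : 3 ≤ m) (h : Ok m s) : down m x (up m x s) = s := by
  obtain ⟨k, l, L⟩ := s
  cases L with
  | nil =>
    have := h.2 rfl
    simp only [] at this
    subst this
    simp [up, down, mk']
  | cons c L =>
    have hc := h.1 c (by simp)
    rw [up]
    split_ifs with h1 h2
    · subst h1
      simp [down, mk']
    · have : l = !x := by revert h1; cases l <;> cases x <;> simp
      subst this
      simp [down]; omega
    · have : l = !x := by revert h1; cases l <;> cases x <;> simp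
      subst this
      have : c = m - 1 := by omega
      subst this
      cases L <;> simp [down, mk']

theorem up_down (hm : 3 ≤ m) (h : Ok m s) : up m x (down m x s) = s := by
  obtain ⟨k, l, L⟩ := s
  have hm1 : ¬ m - 1 + 1 < m := by omega
  cases L with
  | nil =>
    have := h.2 rfl
    simp only [] at this
    subst this
    simp [up, down, mk', hm1]
  | cons c L =>
    have hc := h.1 c (by simp)
    rw [down]
    split_ifs with h1 h2
    · subst h1
      have : c - 1 + 1 < m := by omega
      simp [up, this]; omega
    · subst h1
      have : c = 1 := by omega
      subst this
      cases L <;> simp [up, mk']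
    · have : l = !x := by revert h1; cases l <;> cases x <;> simp
      subst this
      simp [up, mk', hm1]

/-- Multiplication by an alternating word. -/
def run (m : ℕ) (x : Bool) : ℕ → St → St
  | 0, s => s
  | n + 1, s => up m x (run m (!x) n s)

theorem run_add (p q : ℕ) (x : Bool) (s : St) :
    run m x (p + q) s = run m x p (run m (par p x) q s) := by
  induction p generalizing x with
  | zero => rw [zero_add]; rfl
  | succ p ih => rw [Nat.succ_add, run, run, ih, par_not, par_succ]

theorem run_extend (n : ℕ) (x : Bool) (k : ℤ) (c : ℕ) (L : List ℕ) (h : c + n < m) :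
    run m x n ⟨k, par n x, c :: L⟩ = ⟨k, x, (c + n) :: L⟩ := by
  induction n generalizing x with
  | zero => rfl
  | succ n ih =>
    rw [run, par_succ, ← par_not, ih _ (by omega)]
    have h1 : ¬ (!x) = x := by cases x <;> simp
    rw [up, if_neg h1, if_pos (by omega)]
    rfl

theorem up_same (x : Bool) (k : ℤ) (L : List ℕ) : up m x ⟨k, x, L⟩ = ⟨k, x, 1 :: L⟩ := by
  cases L <;> simp [up]

theorem up_mk'_same (x : Bool) (k : ℤ) (L : List ℕ) : up m x (mk' k x L) = ⟨k, x, 1 :: L⟩ := by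
  cases L <;> simp [up, mk']

theorem run_push (n : ℕ) (x : Bool) (k : ℤ) (L : List ℕ) (h : n + 1 < m) :
    run m x (n + 1) (mk' k (par n x) L) = ⟨k, x, (n + 1) :: L⟩ := by
  induction n generalizing x with
  | zero => exact up_mk'_same x k L
  | succ n ih =>
    rw [run, par_succ, ← par_not, ih _ (by omega)]
    have h1 : ¬ (!x) = x := by cases x <;> simp
    rw [up, if_neg h1, if_pos (by omega)]

theorem up_top (hm : 3 ≤ m) (x : Bool) (k : ℤ) (L : List ℕ) :
    up m x ⟨k, !x, (m - 1) :: L⟩ = mk' (k + 1) (!x) L := by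
  have h1 : ¬ (!x) = x := by cases x <;> simp
  rw [up, if_neg h1, if_neg (by omega)]

theorem run_full (hm : 3 ≤ m) (h : Ok m s) (x : Bool) :
    run m x m s = mk' (s.k + 1) (par m s.l) s.L := by
  obtain ⟨k, l, L⟩ := s
  have hfull : ∀ L' : List ℕ, run m x m (mk' k (par (m - 1) x) L') = mk' (k + 1) (!x) L' := by
    intro L'
    obtain ⟨n, rfl⟩ : ∃ n, m = n + 2 := ⟨m - 2, by omega⟩
    rw [run, show par (n + 2 - 1) x = par n (!x) by rw [par_not]; rfl, run_push _ _ _ _ (by omega)]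
    exact up_top hm x k L'
  cases L with
  | nil =>
    have := h.2 rfl
    simp only [] at this
    subst this
    exact hfull []
  | cons c L =>
    have hc := h.1 c (by simp)
    by_cases hl : l = par (m - 1) x
    · subst hl
      have : par m (par (m - 1) x) = !x := by
        obtain ⟨n, rfl⟩ : ∃ n, m = n + 1 := ⟨m - 1, by omega⟩
        rw [par_succ, Nat.add_sub_cancel, par_par]
      rw [this]
      exact hfull (c :: L)
    · have hl' : l = par m x := by
        obtain ⟨n, rfl⟩ : ∃ n, m = n + 1 := ⟨m - 1, by omega⟩
        rw [par_succ]
        rw [Nat.add_sub_cancel] at hl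
        revert hl; cases l <;> cases par n x <;> simp
      subst hl'
      rw [par_par]
      obtain ⟨c, rfl⟩ : ∃ c', c = c' + 1 := ⟨c - 1, by omega⟩
      obtain ⟨q, hq⟩ : ∃ q, m = c + 1 + (q + 1) := ⟨m - (c + 1) - 1, by omega⟩
      have e : par m x = par q (!par (c + 1) x) := by
        rw [par_not, ← par_succ, ← par_add, hq]; congr 1; omega
      have hr : run m (par (c + 1) x) (q + 1) ⟨k, par m x, (c + 1) :: L⟩ =
          mk' (k + 1) (par c x) L := by
        rw [run, e, run_extend _ _ _ _ _ (by omega)]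
        have := up_top hm (par (c + 1) x) k L
        rw [show m - 1 = c + 1 + q by omega] at this
        rw [this, par_succ, Bool.not_not]
      have hr2 : run m x m ⟨k, par m x, (c + 1) :: L⟩ =
          run m x (c + 1) (run m (par (c + 1) x) (q + 1) ⟨k, par m x, (c + 1) :: L⟩) := by
        rw [← run_add, ← hq]
      rw [hr2, hr, run_push _ _ _ _ (by omega)]
      rfl

/-- Left multiplication by a letter, as a permutation. -/
def upPerm (hm : 3 ≤ m) (x : Bool) : Equiv.Perm {s : St // Ok m s} where
  toFun s := ⟨up m x s.1, ok_up hm s.2⟩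
  invFun s := ⟨down m x s.1, ok_down hm s.2⟩
  left_inv s := Subtype.ext (down_up hm s.2)
  right_inv s := Subtype.ext (up_down hm s.2)

theorem altProd_upPerm (hm : 3 ≤ m) (n : ℕ) (x : Bool) (s : {s : St // Ok m s}) :
    (altProd (upPerm hm x) (upPerm hm (!x)) n s).1 = run m x n s.1 := by
  induction n generalizing x with
  | zero => rfl
  | succ n ih =>
    have := ih (!x)
    rw [Bool.not_not] at this
    rw [altProd, Equiv.Perm.mul_apply, run, ← this]
    rfl

/-- The action on normal forms. -/
def toPerm (hm : 3 ≤ m) : DihedralArtin m →* Equiv.Perm {s : St // Ok m s} :=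
  PresentedGroup.toGroup (f := upPerm hm) (by
    intro r hr
    rw [Set.mem_singleton_iff.1 hr, map_mul, map_inv, map_altProd, map_altProd,
      FreeGroup.lift_apply_of, FreeGroup.lift_apply_of, mul_inv_eq_one]
    ext1 s
    apply Subtype.ext
    have h1 := altProd_upPerm hm m true s
    have h2 := altProd_upPerm hm m false s
    rw [run_full hm s.2] at h1 h2
    exact h1.trans h2.symm)

theorem toPerm_of (hm : 3 ≤ m) (x : Bool) : toPerm hm (PresentedGroup.of x) = upPerm hm x :=
  PresentedGroup.toGroup.of _

/-- The alternating product of length `n` starting with `x`. -/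
def alt (m : ℕ) (x : Bool) (n : ℕ) : DihedralArtin m :=
  altProd (PresentedGroup.of x) (PresentedGroup.of !x) n

theorem alt_succ (x : Bool) (n : ℕ) :
    alt m x (n + 1) = PresentedGroup.of x * alt m (!x) n := by
  rw [alt, alt, altProd, Bool.not_not]

theorem alt_succ' (x : Bool) (n : ℕ) :
    alt m x (n + 1) = alt m x n * PresentedGroup.of (par n x) := by
  induction n generalizing x with
  | zero => rw [alt_succ]; simp [alt, altProd, par_zero]
  | succ n ih => rw [alt_succ, ih, alt_succ x n, par_not, par_succ, mul_assoc]

theorem alt_full (m : ℕ) (x y : Bool) : alt m x m = alt m y m := by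
  have key : alt m true m = alt m false m := by
    have h := PresentedGroup.one_of_mem (rels := ({altProd (FreeGroup.of true)
      (FreeGroup.of false) m * (altProd (FreeGroup.of false) (FreeGroup.of true) m)⁻¹} :
      Set (FreeGroup Bool))) rfl
    rw [map_mul, map_inv, map_altProd, map_altProd, mul_inv_eq_one] at h
    exact h
  cases x <;> cases y <;> simp [key]

/-- The Garside element. -/
def garside (m : ℕ) : DihedralArtin m := alt m true m

theorem garside_mul_of (m : ℕ) (x : Bool) :
    garside m * PresentedGroup.of x = PresentedGroup.of (par m x) * garside m := by
  have h1 := alt_succ (m := m) (par m x) m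
  have h2 := alt_succ' (m := m) (par m x) m
  rw [alt_full m _ true] at h1
  rw [alt_full m _ true, par_par, h1] at h2
  exact h2.symm

theorem garside_mul_alt (m n : ℕ) (x : Bool) :
    garside m * alt m x n = alt m (par m x) n * garside m := by
  induction n generalizing x with
  | zero => simp [alt, altProd]
  | succ n ih =>
    rw [alt_succ, alt_succ, ← mul_assoc, garside_mul_of, mul_assoc, ih, par_not, mul_assoc]

/-- The element represented by a normal form. -/
def ev (m : ℕ) (k : ℤ) : Bool → List ℕ → DihedralArtin m
  | _, [] => garside m ^ k
  | l, c :: L => alt m l c * ev m k (par (c + 1) l) L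

theorem garside_mul_ev (k : ℤ) (l : Bool) (L : List ℕ) :
    garside m * ev m k l L = ev m (k + 1) (par m l) L := by
  induction L generalizing l with
  | nil => rw [ev, ev, zpow_add, zpow_one, ← zpow_one_add, ← zpow_add_one, add_comm]
  | cons c L ih =>
    rw [ev, ev, ← mul_assoc, garside_mul_alt, mul_assoc, ih, ← par_add, ← par_add, add_comm m]

theorem ev_mk' (k : ℤ) (l : Bool) (L : List ℕ) :
    ev m (mk' k l L).k (mk' k l L).l (mk' k l L).L = ev m k l L := by
  cases L <;> rfl

theorem ev_up (h : Ok m s) (x : Bool) :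
    ev m (up m x s).k (up m x s).l (up m x s).L = PresentedGroup.of x * ev m s.k s.l s.L := by
  obtain ⟨k, l, L⟩ := s
  have alt_one : alt m x 1 = PresentedGroup.of x := by simp [alt, altProd]
  cases L with
  | nil => simp [up, ev, alt_one]
  | cons c L =>
    have hc := h.1 c (by simp)
    rw [up]
    split_ifs with h1 h2
    · subst h1
      simp [ev, alt_one, par]
    · have : l = !x := by revert h1; cases l <;> cases x <;> simp
      subst this
      simp only [ev]
      rw [alt_succ, par_not, par_succ (c + 1), mul_assoc]
    · have : l = !x := by revert h1; cases l <;> cases x <;> simp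
      subst this
      have : m = c + 1 := by omega
      rw [ev_mk']
      simp only [ev]
      rw [← mul_assoc, ← alt_succ, ← this, alt_full m _ true]
      have := garside_mul_ev (m := m) k (par m !x) L
      rw [par_par] at this
      exact this.symm

theorem ev_toPerm (hm : 3 ≤ m) (w : DihedralArtin m) (s : {s : St // Ok m s}) :
    ev m (toPerm hm w s).1.k (toPerm hm w s).1.l (toPerm hm w s).1.L =
      w * ev m s.1.k s.1.l s.1.L := by
  have hw : w ∈ Subgroup.closure (Set.range PresentedGroup.of) := by
    rw [PresentedGroup.closure_range_of]; trivial
  induction hw using Subgroup.closure_induction generalizing s with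
  | mem g hg =>
    obtain ⟨x, rfl⟩ := hg
    rw [toPerm_of]
    exact ev_up s.2 x
  | one => simp
  | mul g g' _ _ ih ih' => rw [map_mul, Equiv.Perm.mul_apply, ih, ih', mul_assoc]
  | inv g _ ih =>
    have := ih (toPerm hm g⁻¹ s)
    rw [← Equiv.Perm.mul_apply, ← map_mul, mul_inv_cancel, map_one, Equiv.Perm.one_apply] at this
    rw [this, inv_mul_cancel_left]

/-- The normal form of the identity. -/
def base (m : ℕ) : {s : St // Ok m s} := ⟨⟨0, true, []⟩, by simp [Ok]⟩

theorem eq_one_of_toPerm (hm : 3 ≤ m) {w : DihedralArtin m} (h : toPerm hm w (base m) = base m) :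
    w = 1 := by
  have := ev_toPerm hm w (base m)
  rw [h] at this
  simpa [base, ev] using this.symm

end DihedralArtin

namespace DihedralArtin

/-- A family of lower bounds for the word length of a normal form; the maximum over
`0 ≤ t ≤ m` is the word length. -/
def score (m : ℕ) (t : ℤ) (s : St) : ℤ :=
  s.k * (2 * t - m) + (s.L.map fun c : ℕ => min (c : ℤ) (2 * t - c)).sum

section score

variable {m : ℕ} {s : St} {x : Bool} {t : ℤ}

theorem score_nil (k : ℤ) (l : Bool) : score m t ⟨k, l, []⟩ = k * (2 * t - m) := by
  simp [score]

theorem score_cons (k : ℤ) (l l' : Bool) (c : ℕ) (L : List ℕ) :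
    score m t ⟨k, l, c :: L⟩ = min (c : ℤ) (2 * t - c) + score m t ⟨k, l', L⟩ := by
  simp only [score, List.map_cons, List.sum_cons]
  ring

theorem score_succ (k : ℤ) (l l' : Bool) (L : List ℕ) :
    score m t ⟨k + 1, l, L⟩ = score m t ⟨k, l', L⟩ + (2 * t - m) := by
  simp only [score]
  ring

theorem score_mk' (k : ℤ) (l l' : Bool) (L : List ℕ) :
    score m t (mk' k l L) = score m t ⟨k, l', L⟩ := by
  cases L <;> rfl

theorem score_up_push (ht : 0 ≤ t) (h : s.L = [] ∨ s.l = x) :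
    score m t (up m x s) = score m t s + if 1 ≤ t then 1 else -1 := by
  have key : min (1 : ℤ) (2 * t - 1) = if 1 ≤ t then 1 else -1 := by split_ifs <;> omega
  obtain ⟨k, l, L⟩ := s
  cases L with
  | nil => rw [up, score_cons k x l, ← key]; simp; ring
  | cons c L =>
    have h : l = x := by simpa using h
    rw [up, if_pos h, score_cons k x l, ← key]; simp; ring

theorem score_up_grow {k : ℤ} {l : Bool} {c : ℕ} {L : List ℕ} (htm : t ≤ m)
    (hc : c < m) (h : l ≠ x) :
    score m t (up m x ⟨k, l, c :: L⟩) =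
      score m t ⟨k, l, c :: L⟩ + if (c : ℤ) + 1 ≤ t then 1 else -1 := by
  rw [up, if_neg h]
  split_ifs with h1 h2 h2
  · rw [score_cons k x l, score_cons k l l]; push_cast; omega
  · rw [score_cons k x l, score_cons k l l]; push_cast; omega
  · rw [score_mk' _ _ l, score_succ k l l, score_cons k l l]; omega
  · rw [score_mk' _ _ l, score_succ k l l, score_cons k l l]; omega

theorem score_down_push (hm : 3 ≤ m) (htm : t ≤ m) (h : s.L = [] ∨ s.l ≠ x) :
    score m t (down m x s) = score m t s + if t < m then 1 else -1 := by
  have key : min ((m - 1 : ℕ) : ℤ) (2 * t - (m - 1 : ℕ)) =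
    2 * t - m + if t < m then 1 else -1 := by split_ifs <;> omega
  obtain ⟨k, l, L⟩ := s
  have e := score_succ (m := m) (t := t) (k - 1) l l L
  rw [sub_add_cancel] at e
  cases L with
  | nil => rw [down, score_cons _ _ l, key]; omega
  | cons c L =>
    have h : l ≠ x := by simpa using h
    rw [down, if_neg h, score_cons _ _ l, key]; omega

theorem score_down_shrink {k : ℤ} {c : ℕ} {L : List ℕ} (ht : 0 ≤ t) (hc : 1 ≤ c) :
    score m t (down m x ⟨k, x, c :: L⟩) =
      score m t ⟨k, x, c :: L⟩ + if t < c then 1 else -1 := by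
  rw [down, if_pos rfl]
  split_ifs with h1 h2 h2
  · rw [score_cons k _ x, score_cons k x x]; omega
  · rw [score_cons k _ x, score_cons k x x]; omega
  · rw [score_mk' _ _ x, score_cons k x x]; omega
  · rw [score_mk' _ _ x, score_cons k x x]; omega

theorem score_up (ht : 0 ≤ t) (htm : t ≤ m) (h : Ok m s) (x : Bool) :
    score m t (up m x s) = score m t s + 1 ∨ score m t (up m x s) = score m t s - 1 := by
  obtain ⟨k, l, L⟩ := s
  by_cases h1 : L = [] ∨ l = x
  · rw [score_up_push ht h1]; split_ifs <;> simp [sub_eq_add_neg]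
  · cases L with
    | nil => simp at h1
    | cons c L =>
      rw [score_up_grow htm (h.1 c (by simp)).2 (by simpa using h1)]
      split_ifs <;> simp [sub_eq_add_neg]

theorem score_up_or_down (hm : 3 ≤ m) (ht : 0 ≤ t) (htm : t ≤ m) (h : Ok m s) (x : Bool) :
    score m t (up m x s) = score m t s + 1 ∨ score m t (down m x s) = score m t s + 1 := by
  obtain ⟨k, l, L⟩ := s
  cases L with
  | nil =>
    rw [score_up_push ht (Or.inl rfl), score_down_push hm htm (Or.inl rfl)]
    split_ifs <;> simp; omega
  | cons c L =>
    have hc := h.1 c (by simp)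
    by_cases h1 : l = x
    · subst h1
      rw [score_up_push (s := ⟨k, l, c :: L⟩) ht (Or.inr rfl), score_down_shrink ht hc.1]
      split_ifs <;> simp; omega
    · rw [score_up_grow htm hc.2 h1, score_down_push hm htm (Or.inr h1)]
      split_ifs <;> simp; omega

theorem two_dvd_score_sub (t t' : ℤ) (s : St) : 2 ∣ score m t s - score m t' s := by
  obtain ⟨k, l, L⟩ := s
  induction L with
  | nil => rw [score_nil, score_nil]; exact ⟨k * (t - t'), by ring⟩
  | cons c L ih =>
    rw [score_cons k l l, score_cons k l l]
    omega

theorem score_concave {t₁ c t₂ : ℤ} (h₁ : t₁ ≤ c) (h₂ : c ≤ t₂) (s : St) :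
    (t₂ - c) * score m t₁ s + (c - t₁) * score m t₂ s ≤ (t₂ - t₁) * score m c s := by
  obtain ⟨k, l, L⟩ := s
  induction L with
  | nil =>
    simp only [score_nil]
    apply le_of_eq
    ring
  | cons d L ih =>
    simp only [score_cons k l l d L]
    have : (t₂ - c) * min (d : ℤ) (2 * t₁ - d) + (c - t₁) * min (d : ℤ) (2 * t₂ - d) ≤
        (t₂ - t₁) * min (d : ℤ) (2 * c - d) := by
      have a1 := min_le_left (d : ℤ) (2 * t₁ - d)
      have a2 := min_le_right (d : ℤ) (2 * t₁ - d)
      have a3 := min_le_left (d : ℤ) (2 * t₂ - d)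
      have a4 := min_le_right (d : ℤ) (2 * t₂ - d)
      have b₁ := sub_nonneg.2 h₂
      have b₂ := sub_nonneg.2 h₁
      rcases min_choice (d : ℤ) (2 * c - d) with e | e <;> rw [e]
      · nlinarith [mul_le_mul_of_nonneg_left a1 b₁, mul_le_mul_of_nonneg_left a3 b₂]
      · nlinarith [mul_le_mul_of_nonneg_left a2 b₁, mul_le_mul_of_nonneg_left a4 b₂]
    nlinarith

theorem score_self_eq_neg (h : Ok m s) : score m m s = -score m 0 s := by
  obtain ⟨k, l, L⟩ := s
  replace h := h.1
  simp only at h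
  induction L with
  | nil => simp only [score_nil]; ring
  | cons c L ih =>
    have := ih (fun d hd => h d (by simp [hd]))
    have := h c (by simp)
    rw [score_cons k l l, score_cons k l l]
    omega

end score

/-- The word length of a normal form. -/
def size (m : ℕ) (s : St) : ℕ := (Finset.range (m + 1)).sup fun t => (score m t s).toNat

section size

variable {m : ℕ} {s s' : St} {x : Bool}

theorem score_le_size {t : ℤ} (ht : 0 ≤ t) (htm : t ≤ m) : score m t s ≤ size m s := by
  lift t to ℕ using ht
  have := Finset.le_sup (f := fun t : ℕ => (score m t s).toNat)
    (Finset.mem_range.2 (by omega : t < m + 1))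
  exact (Int.self_le_toNat _).trans (by exact_mod_cast this)

theorem exists_score_eq_size (h : Ok m s) : ∃ t : ℤ, 0 ≤ t ∧ t ≤ m ∧ score m t s = size m s := by
  obtain ⟨t, ht, hts⟩ := Finset.exists_mem_eq_sup (Finset.range (m + 1)) ⟨0, by simp⟩
    (fun t : ℕ => (score m t s).toNat)
  have ht := Finset.mem_range.1 ht
  have e := score_self_eq_neg h
  have e0 : score m 0 s ≤ size m s := score_le_size le_rfl (by omega)
  have e1 : score m m s ≤ size m s := score_le_size (by omega) le_rfl
  change size m s = _ at hts
  rcases le_or_gt 0 (score m t s) with h0 | h0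
  · exact ⟨t, by omega, by omega, by omega⟩
  · exact ⟨0, le_rfl, by omega, by omega⟩

theorem size_of_score (h : Ok m s) (h' : Ok m s')
    (hs : ∀ t : ℤ, 0 ≤ t → t ≤ m →
      score m t s' = score m t s + 1 ∨ score m t s' = score m t s - 1) :
    size m s' = size m s + 1 ∨ size m s' + 1 = size m s := by
  obtain ⟨t, ht, htm, e⟩ := exists_score_eq_size h
  obtain ⟨t', ht', htm', e'⟩ := exists_score_eq_size h'
  have a1 := score_le_size (s := s') ht htm
  have a2 := score_le_size (s := s) ht' htm'
  have a3 := hs t ht htm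
  have a4 := hs t' ht' htm'
  have a5 := two_dvd_score_sub (m := m) t t' s
  omega

theorem size_up (hm : 3 ≤ m) (h : Ok m s) (x : Bool) :
    size m (up m x s) = size m s + 1 ∨ size m (up m x s) + 1 = size m s :=
  size_of_score h (ok_up hm h) fun _ ht htm => score_up ht htm h x

theorem score_down (hm : 3 ≤ m) (h : Ok m s) (x : Bool) {t : ℤ} (ht : 0 ≤ t) (htm : t ≤ m) :
    score m t (down m x s) = score m t s + 1 ∨ score m t (down m x s) = score m t s - 1 := by
  have := score_up ht htm (ok_down (x := x) hm h) x
  rw [up_down hm h] at this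
  omega

theorem size_down (hm : 3 ≤ m) (h : Ok m s) (x : Bool) :
    size m (down m x s) = size m s + 1 ∨ size m (down m x s) + 1 = size m s :=
  size_of_score h (ok_down hm h) fun _ ht htm => score_down hm h x ht htm

theorem size_no_peak (hm : 3 ≤ m) (h : Ok m s) (x : Bool) :
    size m s < size m (up m x s) ∨ size m s < size m (down m x s) := by
  obtain ⟨t, ht, htm, e⟩ := exists_score_eq_size h
  have a1 := score_le_size (s := up m x s) ht htm
  have a2 := score_le_size (s := down m x s) ht htm
  have := score_up_or_down hm ht htm h x
  omega

theorem size_up_lt (hm : 3 ≤ m) (h : Ok m s) (hs : ∀ t : ℤ, 0 ≤ t → t ≤ m →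
    score m t s = size m s → score m t (up m x s) = score m t s - 1) :
    size m (up m x s) < size m s := by
  obtain ⟨t, ht, htm, e⟩ := exists_score_eq_size (ok_up (x := x) hm h)
  have a1 := score_le_size (s := s) ht htm
  have a2 := hs t ht htm
  have a3 := score_up ht htm h x
  rcases size_up hm h x with h1 | h1 <;> omega

theorem size_down_lt (hm : 3 ≤ m) (h : Ok m s) (hs : ∀ t : ℤ, 0 ≤ t → t ≤ m →
    score m t s = size m s → score m t (down m x s) = score m t s - 1) :
    size m (down m x s) < size m s := by
  obtain ⟨t, ht, htm, e⟩ := exists_score_eq_size (ok_down (x := x) hm h)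
  have a1 := score_le_size (s := s) ht htm
  have a2 := hs t ht htm
  have a3 := score_down hm h x ht htm
  rcases size_down hm h x with h1 | h1 <;> omega

theorem exists_size_lt (hm : 3 ≤ m) (h : Ok m s) (hs : s ≠ ⟨0, true, []⟩) :
    ∃ x, size m (up m x s) < size m s ∨ size m (down m x s) < size m s := by
  have hs' := fun t : ℤ => score_le_size (m := m) (s := s) (t := t)
  obtain ⟨k, l, L⟩ := s
  cases L with
  | nil =>
    have : l = true := h.2 rfl
    subst this
    have hk : k ≠ 0 := by rintro rfl; exact hs rfl
    simp only [score_nil] at hs'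
    have h0 := hs' 0 le_rfl (by omega)
    have h1 := hs' m (by omega) le_rfl
    rcases lt_or_gt_of_ne hk with hk | hk
    · refine ⟨true, Or.inl (size_up_lt hm h fun t ht htm e => ?_)⟩
      rw [score_up_push ht (Or.inl rfl), if_neg, sub_eq_add_neg]
      rw [score_nil] at e
      intro h
      nlinarith
    · refine ⟨true, Or.inr (size_down_lt hm h fun t ht htm e => ?_)⟩
      rw [score_down_push hm htm (Or.inl rfl), if_neg, sub_eq_add_neg]
      rw [score_nil] at e
      intro h
      nlinarith
  | cons c L =>
    have hc := h.1 c (by simp)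
    by_cases hmax : ∀ t : ℤ, 0 ≤ t → t ≤ m → score m t ⟨k, l, c :: L⟩ = size m ⟨k, l, c :: L⟩ →
        (c : ℤ) ≤ t
    · refine ⟨l, Or.inr (size_down_lt hm h fun t ht htm e => ?_)⟩
      rw [score_down_shrink ht hc.1, if_neg (not_lt.2 (hmax t ht htm e)), sub_eq_add_neg]
    · push Not at hmax
      obtain ⟨t₁, ht₁, htm₁, e₁, hlt⟩ := hmax
      refine ⟨!l, Or.inl (size_up_lt hm h fun t ht htm e => ?_)⟩
      rw [score_up_grow htm hc.2 (by simp), if_neg, sub_eq_add_neg]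
      intro hct
      have hct : (c : ℤ) < t := by omega
      have hcon := score_concave (m := m) hlt.le hct.le ⟨k, l, L⟩
      have hcs := hs' c (by omega) (by omega)
      rw [← e₁] at hcs e
      rw [score_cons k l l, score_cons k l l] at hcs e
      have m1 : min (c : ℤ) (2 * c - c) = c := by omega
      have m2 : min (c : ℤ) (2 * t - c) = c := by omega
      have m3 : min (c : ℤ) (2 * t₁ - c) = 2 * t₁ - c := by omega
      rw [m1, m3] at hcs
      rw [m2, m3] at e
      have e' : score m t ⟨k, l, L⟩ = 2 * t₁ - 2 * c + score m t₁ ⟨k, l, L⟩ := by linarith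
      rw [e'] at hcon
      have hcs' : score m c ⟨k, l, L⟩ ≤ 2 * t₁ - 2 * c + score m t₁ ⟨k, l, L⟩ := by linarith
      have := mul_le_mul_of_nonneg_left hcs' (by omega : 0 ≤ t - t₁)
      nlinarith

end size

end DihedralArtin

namespace DihedralArtin

section iterate

variable {m : ℕ} {x : Bool} {t : ℤ}

theorem up_iterate (n : ℕ) (k : ℤ) (L : List ℕ) :
    (up m x)^[n] ⟨k, x, L⟩ = ⟨k, x, List.replicate n 1 ++ L⟩ := by
  induction n with
  | zero => rfl
  | succ n ih =>
    rw [Function.iterate_succ_apply', ih, up_same, List.replicate_succ, List.cons_append]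

theorem down_push (k : ℤ) (L : List ℕ) :
    down m x ⟨k, !x, L⟩ = ⟨k - 1, !x, (m - 1) :: L⟩ := by
  cases L <;> simp [down]

theorem down_iterate (n : ℕ) (k : ℤ) (L : List ℕ) :
    (down m x)^[n] ⟨k, !x, L⟩ = ⟨k - n, !x, List.replicate n (m - 1) ++ L⟩ := by
  induction n with
  | zero => simp
  | succ n ih =>
    rw [Function.iterate_succ_apply', ih, down_push, List.replicate_succ, List.cons_append]
    congr 1
    push_cast
    ring

theorem up_iterate_succ (n : ℕ) (k : ℤ) (L : List ℕ) :
    (up m x)^[n + 1] (mk' k x L) = ⟨k, x, 1 :: (List.replicate n 1 ++ L)⟩ := by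
  have : up m x (mk' k x L) = up m x ⟨k, x, L⟩ := by cases L <;> rfl
  rw [Function.iterate_succ_apply, this, ← Function.iterate_succ_apply, up_iterate]
  rfl

theorem down_iterate_succ (n : ℕ) (k : ℤ) (L : List ℕ) :
    (down m x)^[n + 1] (mk' k (!x) L) =
      ⟨k - (n + 1 : ℕ), !x, (m - 1) :: (List.replicate n (m - 1) ++ L)⟩ := by
  have : down m x (mk' k (!x) L) = down m x ⟨k, !x, L⟩ := by cases L <;> rfl
  rw [Function.iterate_succ_apply, this, ← Function.iterate_succ_apply, down_iterate]
  rfl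

theorem up_iterate_base (n : ℕ) :
    (up m x)^[n] ⟨0, true, []⟩ = mk' 0 x (List.replicate n 1) := by
  cases n with
  | zero => rfl
  | succ n =>
    have := up_iterate (m := m) (x := x) (n + 1) 0 []
    rw [List.append_nil] at this
    exact this

theorem down_iterate_base (n : ℕ) :
    (down m x)^[n] ⟨0, true, []⟩ = mk' (-n) (!x) (List.replicate n (m - 1)) := by
  cases n with
  | zero => rfl
  | succ n =>
    have := down_iterate (m := m) (x := x) (n + 1) 0 []
    rw [zero_sub, List.append_nil] at this
    exact this

theorem score_replicate (k : ℤ) (l : Bool) (n c : ℕ) (L : List ℕ) :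
    score m t ⟨k, l, List.replicate n c ++ L⟩ =
      n * min (c : ℤ) (2 * t - c) + score m t ⟨k, l, L⟩ := by
  simp [score]
  ring

end iterate

section length

variable {m : ℕ}

theorem coe_upPerm_pow (hm : 3 ≤ m) (x : Bool) (n : ℕ) (s : {s : St // Ok m s}) :
    ((upPerm hm x ^ n) s).1 = (up m x)^[n] s.1 := by
  induction n with
  | zero => rfl
  | succ n ih => rw [pow_succ', Equiv.Perm.mul_apply, Function.iterate_succ_apply', ← ih]; rfl

theorem coe_upPerm_inv_pow (hm : 3 ≤ m) (x : Bool) (n : ℕ) (s : {s : St // Ok m s}) :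
    (((upPerm hm x)⁻¹ ^ n) s).1 = (down m x)^[n] s.1 := by
  induction n with
  | zero => rfl
  | succ n ih => rw [pow_succ', Equiv.Perm.mul_apply, Function.iterate_succ_apply', ← ih]; rfl

/-- The word length in the dihedral Artin group. -/
def length (hm : 3 ≤ m) (w : DihedralArtin m) : ℕ := size m (toPerm hm w (base m)).1

theorem toPerm_of_mul (hm : 3 ≤ m) (x : Bool) (w : DihedralArtin m) :
    (toPerm hm (PresentedGroup.of x * w) (base m)).1 = up m x (toPerm hm w (base m)).1 := by
  rw [map_mul, toPerm_of]; rfl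

theorem toPerm_of_inv_mul (hm : 3 ≤ m) (x : Bool) (w : DihedralArtin m) :
    (toPerm hm ((PresentedGroup.of x)⁻¹ * w) (base m)).1 =
      down m x (toPerm hm w (base m)).1 := by
  rw [map_mul, map_inv, toPerm_of]; rfl

theorem toPerm_of_pow_mul (hm : 3 ≤ m) (x : Bool) (n : ℕ) (w : DihedralArtin m) :
    (toPerm hm (PresentedGroup.of x ^ n * w) (base m)).1 =
      (up m x)^[n] (toPerm hm w (base m)).1 := by
  rw [map_mul, map_pow, toPerm_of, Equiv.Perm.mul_apply, coe_upPerm_pow]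

theorem toPerm_of_inv_pow_mul (hm : 3 ≤ m) (x : Bool) (n : ℕ) (w : DihedralArtin m) :
    (toPerm hm ((PresentedGroup.of x)⁻¹ ^ n * w) (base m)).1 =
      (down m x)^[n] (toPerm hm w (base m)).1 := by
  rw [map_mul, map_pow, map_inv, toPerm_of, Equiv.Perm.mul_apply, coe_upPerm_inv_pow]

theorem length_one (hm : 3 ≤ m) : length hm 1 = 0 := by
  rw [length, map_one]
  simp [size, base, score]

theorem length_pow_mul_le (hm : 3 ≤ m) (x : Bool) (n : ℕ) (w : DihedralArtin m) :
    length hm (PresentedGroup.of x ^ n * w) ≤ n + length hm w ∧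
    length hm ((PresentedGroup.of x)⁻¹ ^ n * w) ≤ n + length hm w := by
  induction n with
  | zero => simp
  | succ n ih =>
    rw [pow_succ', pow_succ', mul_assoc, mul_assoc]
    have h1 := size_up hm (toPerm hm (PresentedGroup.of x ^ n * w) (base m)).2 x
    have h2 := size_down hm (toPerm hm ((PresentedGroup.of x)⁻¹ ^ n * w) (base m)).2 x
    rw [← toPerm_of_mul] at h1
    rw [← toPerm_of_inv_mul] at h2
    change length hm _ = length hm _ + 1 ∨ length hm _ + 1 = length hm _ at h1 h2
    omega

theorem length_zpow_mul_le (hm : 3 ≤ m) (x : Bool) (n : ℤ) (w : DihedralArtin m) :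
    length hm (PresentedGroup.of x ^ n * w) ≤ n.natAbs + length hm w := by
  obtain ⟨n, rfl | rfl⟩ := n.eq_nat_or_neg
  · rw [zpow_natCast, Int.natAbs_natCast]
    exact (length_pow_mul_le hm x n w).1
  · rw [zpow_neg, zpow_natCast, Int.natAbs_neg, Int.natAbs_natCast, ← inv_pow]
    exact (length_pow_mul_le hm x n w).2

theorem score_up_self (hm : 3 ≤ m) {s : St} (h : Ok m s) (x : Bool) :
    score m m (up m x s) = score m m s + 1 := by
  obtain ⟨k, l, L⟩ := s
  by_cases h1 : L = [] ∨ l = x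
  · rw [score_up_push (by omega) h1, if_pos (by omega)]
  · cases L with
    | nil => simp at h1
    | cons c L =>
      have hc := h.1 c (by simp)
      rw [score_up_grow le_rfl hc.2 (by simpa using h1), if_pos (by omega)]

theorem score_down_zero (hm : 3 ≤ m) {s : St} (h : Ok m s) (x : Bool) :
    score m 0 (down m x s) = score m 0 s + 1 := by
  have h1 := score_up_self hm (ok_down (x := x) hm h) x
  rw [up_down hm h, score_self_eq_neg h, score_self_eq_neg (ok_down hm h)] at h1
  omega

/-- The normal forms of the products `x ^ i * (!x) ^ j` can be lengthened by the letter `!x`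
and by its inverse. -/
theorem exists_score_up_down (hm : 3 ≤ m) (x : Bool) (i j : ℤ) (hi : i ≠ 0) (s : St)
    (hs : s = (toPerm hm (PresentedGroup.of x ^ i * PresentedGroup.of (!x) ^ j) (base m)).1) :
    (∃ t : ℤ, 0 ≤ t ∧ t ≤ m ∧ score m t (up m (!x) s) = i.natAbs + j.natAbs + 1) ∧
    (∃ t : ℤ, 0 ≤ t ∧ t ≤ m ∧ score m t (down m (!x) s) = i.natAbs + j.natAbs + 1) := by
  have hok : Ok m s := by rw [hs]; exact Subtype.property _
  have hbase : ((base m).1 : St) = ⟨0, true, []⟩ := rfl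
  have hx : x ≠ !x := by simp
  have hx' : ¬ (!x) = x := by simp
  have q1 : ∀ t : ℤ, 1 ≤ t → min ((1 : ℕ) : ℤ) (2 * t - (1 : ℕ)) = 1 := by omega
  have q2 : ∀ t : ℤ, 2 ≤ t → min ((2 : ℕ) : ℤ) (2 * t - (2 : ℕ)) = 2 := by omega
  have q3 : ∀ t : ℤ, t < m → min ((m - 1 : ℕ) : ℤ) (2 * t - (m - 1 : ℕ)) = 2 * t - m + 1 := by
    omega
  have q4 : ∀ t : ℤ, t + 1 < m → min ((m - 2 : ℕ) : ℤ) (2 * t - (m - 2 : ℕ)) = 2 * t - m + 2 := by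
    omega
  rw [← mul_one (PresentedGroup.of (!x) ^ j)] at hs
  obtain ⟨p, rfl | rfl⟩ := i.eq_nat_or_neg
  · obtain ⟨p, rfl⟩ : ∃ q, p = q + 1 := ⟨p - 1, by omega⟩
    rw [zpow_natCast, toPerm_of_pow_mul] at hs
    simp only [Int.natAbs_natCast]
    by_cases hj : 0 < j
    · lift j to ℕ using hj.le
      obtain ⟨n, rfl⟩ : ∃ q, j = q + 1 := ⟨j - 1, by omega⟩
      have e : up m x ⟨0, !x, 1 :: List.replicate n 1⟩ = ⟨0, x, 2 :: List.replicate n 1⟩ := by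
        rw [up, if_neg hx', if_pos (by omega)]
      rw [zpow_natCast, toPerm_of_pow_mul, map_one, Equiv.Perm.one_apply, hbase,
        up_iterate_base, List.replicate_succ, mk', Function.iterate_succ_apply, e,
        up_iterate, ← List.append_nil (List.replicate n 1)] at hs
      have key : ∀ t : ℤ, 2 ≤ t → score m t s = p + n + 2 := by
        intro t ht
        rw [hs, score_replicate, score_cons _ _ x, score_replicate, score_nil, q1 _ (by omega),
          q2 _ ht]
        ring
      simp only [Int.natAbs_natCast]
      constructor
      · refine ⟨m, by omega, le_rfl, ?_⟩
        rw [score_up_self hm hok, key _ (by omega)]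
        push_cast
        ring
      · refine ⟨2, by omega, by omega, ?_⟩
        rw [score_down_push hm (by omega) (Or.inr (by rw [hs]; exact hx)), key _ le_rfl,
          if_pos (by omega)]
        push_cast
        ring
    · obtain ⟨n, rfl⟩ : ∃ n : ℕ, j = -n := ⟨(-j).toNat, by omega⟩
      rw [zpow_neg, zpow_natCast, ← inv_pow, toPerm_of_inv_pow_mul, map_one,
        Equiv.Perm.one_apply, hbase, down_iterate_base, Bool.not_not, up_iterate_succ,
        ← List.append_nil (List.replicate n (m - 1))] at hs
      have key : score m 2 s = p + n + 1 := by
        rw [hs, score_cons _ _ x, score_replicate, score_replicate, score_nil, q1 _ (by omega),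
          q3 _ (by omega)]
        ring
      simp only [Int.natAbs_neg, Int.natAbs_natCast]
      constructor
      · refine ⟨2, by omega, by omega, ?_⟩
        rw [hs, score_up_grow (by omega) (by omega) hx, ← hs, key, if_pos (by simp)]
        push_cast
        ring
      · refine ⟨2, by omega, by omega, ?_⟩
        rw [score_down_push hm (by omega) (Or.inr (by rw [hs]; exact hx)), key,
          if_pos (by omega)]
        push_cast
        ring
  · obtain ⟨p, rfl⟩ : ∃ q, p = q + 1 := ⟨p - 1, by omega⟩
    rw [zpow_neg, zpow_natCast, ← inv_pow, toPerm_of_inv_pow_mul] at hs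
    simp only [Int.natAbs_neg, Int.natAbs_natCast]
    by_cases hj : 0 ≤ j
    · lift j to ℕ using hj
      rw [zpow_natCast, toPerm_of_pow_mul, map_one, Equiv.Perm.one_apply, hbase,
        up_iterate_base, down_iterate_succ, ← List.append_nil (List.replicate j 1)] at hs
      have key : score m 1 s = p + j + 1 := by
        rw [hs, score_cons _ _ x, score_replicate, score_replicate, score_nil, q1 _ (by omega),
          q3 _ (by omega)]
        push_cast
        ring
      simp only [Int.natAbs_natCast]
      constructor
      · refine ⟨1, by omega, by omega, ?_⟩
        rw [score_up_push (by omega) (Or.inr (by rw [hs])), key, if_pos le_rfl]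
        push_cast
        ring
      · refine ⟨1, by omega, by omega, ?_⟩
        rw [hs, score_down_shrink (by omega) (by omega), ← hs, key, if_pos (by omega)]
        push_cast
        ring
    · obtain ⟨n, rfl⟩ : ∃ n : ℕ, j = -(n + 1 : ℕ) := ⟨(-j - 1).toNat, by omega⟩
      have e : ∀ k L, down m x ⟨k, x, (m - 1) :: L⟩ = ⟨k, !x, (m - 2) :: L⟩ := by
        intro k L
        rw [down, if_pos rfl, if_pos (by omega)]
        rfl
      rw [zpow_neg, zpow_natCast, ← inv_pow, toPerm_of_inv_pow_mul, map_one,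
        Equiv.Perm.one_apply, hbase, down_iterate_base, Bool.not_not, List.replicate_succ, mk',
        Function.iterate_succ_apply, e, down_iterate,
        ← List.append_nil (List.replicate n (m - 1))] at hs
      have key : ∀ t : ℤ, t + 1 < m → score m t s = p + n + 2 := by
        intro t ht
        rw [hs, score_replicate, score_cons _ _ x, score_replicate, score_nil, q3 _ (by omega),
          q4 _ ht]
        push_cast
        ring
      simp only [Int.natAbs_neg, Int.natAbs_natCast]
      constructor
      · refine ⟨1, by omega, by omega, ?_⟩
        rw [score_up_push (by omega) (Or.inr (by rw [hs])), key _ (by omega), if_pos le_rfl]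
        push_cast
        ring
      · refine ⟨0, by omega, by omega, ?_⟩
        rw [score_down_zero hm hok, key _ (by omega)]
        push_cast
        ring

theorem letterLength (hm : 3 ≤ m) :
    LetterLength (PresentedGroup.of : Bool → DihedralArtin m) (length hm) where
  one := length_one hm
  step x w := by
    rw [length, toPerm_of_mul]
    exact size_up hm (toPerm hm w (base m)).2 x
  no_peak x w := by
    rw [length, length, length, toPerm_of_mul, toPerm_of_inv_mul]
    exact size_no_peak hm (toPerm hm w (base m)).2 x
  descent w hw := by
    obtain ⟨x, hx⟩ := exists_size_lt hm (toPerm hm w (base m)).2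
      (fun h => hw (eq_one_of_toPerm hm (Subtype.ext h)))
    rw [← toPerm_of_mul, ← toPerm_of_inv_mul] at hx
    exact ⟨x, hx⟩
  sep x i j hi := by
    obtain ⟨⟨t, ht, htm, e⟩, ⟨t', ht', htm', e'⟩⟩ := exists_score_up_down hm x i j hi _ rfl
    rw [← toPerm_of_mul] at e
    rw [← toPerm_of_inv_mul] at e'
    have h1 := score_le_size ht htm (s := (toPerm hm (PresentedGroup.of (!x) *
      (PresentedGroup.of x ^ i * PresentedGroup.of (!x) ^ j)) (base m)).1)
    have h2 := score_le_size ht' htm' (s := (toPerm hm ((PresentedGroup.of (!x))⁻¹ *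
      (PresentedGroup.of x ^ i * PresentedGroup.of (!x) ^ j)) (base m)).1)
    have h3 := length_zpow_mul_le hm x i (PresentedGroup.of (!x) ^ j)
    have h4 := length_zpow_mul_le hm (!x) j 1
    rw [mul_one, length_one] at h4
    rw [e] at h1
    rw [e'] at h2
    change _ ≤ ((length hm _ : ℕ) : ℤ) at h1 h2
    omega

end length

end DihedralArtin

namespace DihedralArtin

/-- A letter or its inverse in the free group. -/
def freeLetter (p : Bool × Bool) : FreeGroup Bool := FreeGroup.mk [p]

theorem toWord_freeLetter_mul (p : Bool × Bool) (w : FreeGroup Bool) :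
    ((freeLetter p * w).toWord = p :: w.toWord ∧ w.toWord.head? ≠ some (p.1, !p.2)) ∨
      w.toWord = (p.1, !p.2) :: (freeLetter p * w).toWord := by
  have h1 : freeLetter p * w = FreeGroup.mk (p :: w.toWord) := by
    conv_lhs => rw [← FreeGroup.mk_toWord (x := w), freeLetter, FreeGroup.mul_mk]
    rfl
  have h2 := FreeGroup.reduce_toWord w
  rw [h1, FreeGroup.toWord_mk, FreeGroup.reduce.cons, h2]
  cases hw : w.toWord with
  | nil => simp
  | cons q L =>
    obtain ⟨p1, p2⟩ := p
    obtain ⟨q1, q2⟩ := q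
    by_cases h : p1 = q1 ∧ p2 = !q2
    · right
      simp [h]
    · left
      refine ⟨by simp [h], ?_⟩
      simp only [List.head?_cons, ne_eq, Option.some.injEq, Prod.mk.injEq]
      rintro ⟨rfl, rfl⟩
      exact h ⟨rfl, by simp⟩

theorem norm_lt_of_head? {p : Bool × Bool} {w : FreeGroup Bool}
    (h : w.toWord.head? ≠ some (p.1, !p.2)) : w.norm < (freeLetter p * w).norm := by
  rcases toWord_freeLetter_mul p w with ⟨e, -⟩ | e
  · rw [FreeGroup.norm, FreeGroup.norm, e]; simp
  · rw [e] at h; simp at h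

theorem head?_freeLetter_pow_mul {p : Bool × Bool} {w : FreeGroup Bool}
    (h : w.toWord.head? ≠ some (p.1, !p.2)) (n : ℕ) :
    (freeLetter p ^ (n + 1) * w).toWord.head? = some p := by
  have key : ∀ v : FreeGroup Bool, v.toWord.head? ≠ some (p.1, !p.2) →
      (freeLetter p * v).toWord.head? = some p := by
    intro v hv
    rcases toWord_freeLetter_mul p v with ⟨e, -⟩ | e
    · rw [e]; rfl
    · rw [e] at hv; simp at hv
  induction n with
  | zero => rw [zero_add, pow_one]; exact key w h
  | succ n ih =>
    rw [pow_succ', mul_assoc]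
    refine key _ ?_
    rw [ih]
    obtain ⟨p1, p2⟩ := p
    simp

theorem of_eq_freeLetter (x : Bool) : FreeGroup.of x = freeLetter (x, true) := rfl

theorem of_inv_eq_freeLetter (x : Bool) : (FreeGroup.of x)⁻¹ = freeLetter (x, false) := rfl

theorem head?_of_zpow_mul {x : Bool} {w : FreeGroup Bool} (h : ∀ b, w.toWord.head? ≠ some (x, b))
    {n : ℤ} (hn : n ≠ 0) : ∃ b, (FreeGroup.of x ^ n * w).toWord.head? = some (x, b) := by
  obtain ⟨p, rfl | rfl⟩ := n.eq_nat_or_neg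
  all_goals obtain ⟨p, rfl⟩ : ∃ q, p = q + 1 := ⟨p - 1, by omega⟩
  · rw [zpow_natCast, of_eq_freeLetter]
    exact ⟨true, head?_freeLetter_pow_mul (h _) p⟩
  · rw [zpow_neg, zpow_natCast, ← inv_pow, of_inv_eq_freeLetter]
    exact ⟨false, head?_freeLetter_pow_mul (h _) p⟩

theorem letterLength_freeGroup :
    LetterLength (FreeGroup.of : Bool → FreeGroup Bool) FreeGroup.norm where
  one := FreeGroup.norm_one
  step x w := by
    rw [of_eq_freeLetter, FreeGroup.norm, FreeGroup.norm]
    rcases toWord_freeLetter_mul (x, true) w with ⟨e, -⟩ | e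
    · left; rw [e]; simp
    · right; conv_rhs => rw [e]
      simp
  no_peak x w := by
    rw [of_inv_eq_freeLetter, of_eq_freeLetter]
    by_cases h : w.toWord.head? = some (x, false)
    · exact Or.inr (norm_lt_of_head? (by rw [h]; simp))
    · exact Or.inl (norm_lt_of_head? h)
  descent w hw := by
    have hw' : w.toWord ≠ [] := by rwa [ne_eq, FreeGroup.toWord_eq_nil_iff]
    obtain ⟨⟨x, b⟩, L, hL⟩ := List.exists_cons_of_ne_nil hw'
    have key : (freeLetter (x, !b) * w).norm < w.norm := by
      rcases toWord_freeLetter_mul (x, !b) w with ⟨-, e⟩ | e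
      · simp [hL] at e
      · rw [FreeGroup.norm, FreeGroup.norm]
        conv_rhs => rw [e]
        simp
    refine ⟨x, ?_⟩
    rw [of_inv_eq_freeLetter, of_eq_freeLetter]
    cases b
    · exact Or.inl key
    · exact Or.inr key
  sep x i j hi := by
    have h1 : ∀ b, ((FreeGroup.of (!x)) ^ j).toWord.head? ≠ some (x, b) := by
      intro b
      by_cases hj : j = 0
      · simp [hj]
      · obtain ⟨b', hb⟩ := head?_of_zpow_mul (x := !x) (w := 1) (by simp) hj
        rw [mul_one] at hb
        simp [hb]
    obtain ⟨b, hb⟩ := head?_of_zpow_mul h1 hi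
    constructor
    · rw [of_eq_freeLetter (!x)] at hb ⊢
      exact norm_lt_of_head? (by rw [hb]; simp)
    · rw [of_inv_eq_freeLetter]
      exact norm_lt_of_head? (by rw [hb]; simp)

end DihedralArtin

theorem LetterLength.comap {G K : Type*} [Group G] [Group K] {g : Bool → G} {g' : Bool → K}
    {ℓ : K → ℕ} (H : LetterLength g' ℓ) (f : G →* K) (hf : Function.Injective f)
    (hg : ∀ x, f (g x) = g' x) : LetterLength g (ℓ ∘ f) where
  one := by simp [H.one]
  step x w := by simpa [hg] using H.step x (f w)
  no_peak x w := by simpa [hg] using H.no_peak x (f w)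
  descent w hw := by simpa [hg] using H.descent (f w) (by simpa using hf.ne hw)
  sep x i j hi := by simpa [hg] using H.sep x i j hi

theorem DihedralArtin.exists_letterLength {m : ℕ} (hm : m = 0 ∨ 3 ≤ m) :
    ∃ ℓ, LetterLength (PresentedGroup.of : Bool → DihedralArtin m) ℓ := by
  rcases hm with rfl | hm
  · have hrel : ∀ r ∈ ({altProd (FreeGroup.of true) (FreeGroup.of false) 0 *
        (altProd (FreeGroup.of false) (FreeGroup.of true) 0)⁻¹} : Set (FreeGroup Bool)),
        FreeGroup.lift FreeGroup.of r = 1 := by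
      intro r hr
      rw [Set.mem_singleton_iff.1 hr]
      simp [altProd]
    let f : DihedralArtin 0 →* FreeGroup Bool := PresentedGroup.toGroup hrel
    have hf : ∀ x, f (PresentedGroup.of x) = FreeGroup.of x := fun x => PresentedGroup.toGroup.of _
    let f' : FreeGroup Bool →* DihedralArtin 0 := PresentedGroup.mk _
    have hff : f'.comp f = MonoidHom.id _ := by
      apply PresentedGroup.ext
      intro x
      rw [MonoidHom.comp_apply, hf]
      rfl
    have hinj : Function.Injective f := Function.LeftInverse.injective (g := f')
      (fun w => DFunLike.congr_fun hff w)
    exact ⟨_, letterLength_freeGroup.comap f hinj hf⟩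
  · exact ⟨_, letterLength hm⟩

namespace DefiningGraph

variable {V : Type*} (Γ : DefiningGraph V)

/-- A labelling of the two vertices of a pair. -/
noncomputable def vertex (X : Sym2 V) (b : Bool) : V := if b then (Quot.out X).1 else (Quot.out X).2

open Classical in
/-- The letter of a vertex of a pair. -/
noncomputable def letter (X : Sym2 V) (x : V) : Bool := decide (x = vertex X true)

open Classical in
/-- The label of a pair of vertices, with `0` standing for the absence of an edge. -/
noncomputable def pairLabel (X : Sym2 V) : ℕ :=
  if Γ.graph.Adj (vertex X true) (vertex X false) then Γ.label (vertex X true) (vertex X false)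
  else 0

theorem mk_vertex (X : Sym2 V) : s(vertex X true, vertex X false) = X := Quot.out_eq X

theorem vertex_mem (X : Sym2 V) (b : Bool) : vertex X b ∈ X := by
  have h : vertex X b ∈ s(vertex X true, vertex X false) := by cases b <;> simp
  rwa [mk_vertex] at h

theorem letter_vertex {X : Sym2 V} (hX : ¬ X.IsDiag) (b : Bool) : letter X (vertex X b) = b := by
  have h : vertex X true ≠ vertex X false := by
    rwa [← mk_vertex X, Sym2.mk_isDiag_iff] at hX
  cases b
  · simp [letter, h.symm]
  · simp [letter]

theorem vertex_letter {X : Sym2 V} {x : V} (hx : x ∈ X) : vertex X (letter X x) = x := by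
  rw [← mk_vertex X, Sym2.mem_iff] at hx
  by_cases h : x = vertex X true
  · simp [letter, ← h]
  · simp [letter, h, (hx.resolve_left h).symm]

theorem altProd_of_eq {a b : V} (h : Γ.graph.Adj a b) :
    altProd (PresentedGroup.of a : ArtinGroup Γ) (PresentedGroup.of b) (Γ.label a b) =
      altProd (PresentedGroup.of b) (PresentedGroup.of a) (Γ.label a b) := by
  have := PresentedGroup.one_of_mem (rels := Γ.rels) ⟨a, b, h, rfl⟩
  rwa [map_mul, map_inv, map_altProd, map_altProd, mul_inv_eq_one] at this

theorem altProd_vertex_eq (X : Sym2 V) :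
    altProd (PresentedGroup.of (vertex X true) : ArtinGroup Γ)
      (PresentedGroup.of (vertex X false)) (Γ.pairLabel X) =
    altProd (PresentedGroup.of (vertex X false))
      (PresentedGroup.of (vertex X true)) (Γ.pairLabel X) := by
  unfold pairLabel
  split_ifs with h
  · exact Γ.altProd_of_eq h
  · rfl

/-- The homomorphism to the Artin group from the group of a pair of vertices. -/
noncomputable def pairHom (X : Sym2 V) : DihedralArtin (Γ.pairLabel X) →* ArtinGroup Γ :=
  PresentedGroup.toGroup (f := fun b => PresentedGroup.of (vertex X b)) (by
    intro r hr
    rw [Set.mem_singleton_iff.1 hr, map_mul, map_inv, map_altProd, map_altProd,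
      FreeGroup.lift_apply_of, FreeGroup.lift_apply_of, mul_inv_eq_one]
    exact Γ.altProd_vertex_eq X)

variable {Γ}

theorem pairLabel_eq (hlarge : ∀ a b : V, Γ.graph.Adj a b → 3 ≤ Γ.label a b) (X : Sym2 V) :
    Γ.pairLabel X = 0 ∨ 3 ≤ Γ.pairLabel X := by
  unfold pairLabel
  split_ifs with h
  · exact Or.inr (hlarge _ _ h)
  · exact Or.inl rfl

theorem pairLabel_mk {a b : V} (h : Γ.graph.Adj a b) : Γ.pairLabel s(a, b) = Γ.label a b := by
  rcases Sym2.eq_iff.1 (mk_vertex s(a, b)) with ⟨h1, h2⟩ | ⟨h1, h2⟩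
  · rw [pairLabel, h1, h2, if_pos h]
  · rw [pairLabel, h1, h2, if_pos h.symm, Γ.label_symm]

/-- The groups of the pairs of vertices of a large-type Artin group. -/
noncomputable def localSystem (hlarge : ∀ a b : V, Γ.graph.Adj a b → 3 ≤ Γ.label a b) :
    LocalSystem V (ArtinGroup Γ) PresentedGroup.of where
  G X := DihedralArtin (Γ.pairLabel X)
  gen X x := PresentedGroup.of (letter X x)
  len X := (DihedralArtin.exists_letterLength (pairLabel_eq hlarge X)).choose
  j X := Γ.pairHom X
  j_gen X x _ hx := by
    refine (PresentedGroup.toGroup.of _).trans ?_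
    rw [vertex_letter hx]
  len_one X := (DihedralArtin.exists_letterLength (pairLabel_eq hlarge X)).choose_spec.one
  exists_gate X x w :=
    (DihedralArtin.exists_letterLength (pairLabel_eq hlarge X)).choose_spec.exists_gate _ w
  eq_one X w hX h := by
    refine (DihedralArtin.exists_letterLength (pairLabel_eq hlarge X)).choose_spec.eq_one ?_
    intro b k
    have := h _ (vertex_mem X b) k
    rwa [letter_vertex hX] at this
  sep X x y _ hx hy hxy n i hn k := by
    refine (DihedralArtin.exists_letterLength (pairLabel_eq hlarge X)).choose_spec.sep_eq ?_ hn i k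
    intro h
    rw [← vertex_letter hx, h, vertex_letter hy] at hxy
    exact hxy rfl

theorem altProd_genPerm_eq (hlarge : ∀ a b : V, Γ.graph.Adj a b → 3 ≤ Γ.label a b) {a b : V}
    (h : Γ.graph.Adj a b) :
    altProd (LocalSystem.genPerm (S := localSystem hlarge) a) (LocalSystem.genPerm b)
      (Γ.label a b) = altProd (LocalSystem.genPerm b) (LocalSystem.genPerm a) (Γ.label a b) := by
  have hX : ¬ s(a, b).IsDiag := h.ne
  have hne : letter s(a, b) a ≠ letter s(a, b) b := by
    intro e
    have h1 := vertex_letter (Sym2.mem_mk_left a b)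
    rw [e, vertex_letter (Sym2.mem_mk_right a b)] at h1
    exact h.ne h1.symm
  have hrel : altProd (PresentedGroup.of (letter s(a, b) a) : DihedralArtin (Γ.pairLabel s(a, b)))
      (PresentedGroup.of (letter s(a, b) b)) (Γ.pairLabel s(a, b)) =
      altProd (PresentedGroup.of (letter s(a, b) b)) (PresentedGroup.of (letter s(a, b) a))
        (Γ.pairLabel s(a, b)) := by
    have := DihedralArtin.alt_full (Γ.pairLabel s(a, b)) true false
    revert hne
    cases letter s(a, b) a <;> cases letter s(a, b) b <;> intro hne
    · exact absurd rfl hne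
    · exact this.symm
    · exact this
    · exact absurd rfl hne
  have := congrArg (LocalSystem.localHom (S := localSystem hlarge) s(a, b) hX) hrel
  erw [map_altProd, map_altProd] at this
  rw [← pairLabel_mk h, ← LocalSystem.localHom_gen hX (Sym2.mem_mk_left a b),
    ← LocalSystem.localHom_gen hX (Sym2.mem_mk_right a b)]
  exact this

theorem exists_isLength (hlarge : ∀ a b : V, Γ.graph.Adj a b → 3 ≤ Γ.label a b) :
    ∃ ℓ, LocalSystem.IsLength (localSystem hlarge) ℓ := by
  have hrel : ∀ r ∈ Γ.rels,
      FreeGroup.lift (LocalSystem.genPerm (S := localSystem hlarge)) r = 1 := by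
    rintro r ⟨a, b, h, rfl⟩
    rw [map_mul, map_inv, map_altProd, map_altProd, FreeGroup.lift_apply_of,
      FreeGroup.lift_apply_of, mul_inv_eq_one]
    exact altProd_genPerm_eq hlarge h
  obtain ⟨ℓ, h1, h2, h3, h4⟩ := (localSystem hlarge).exists_length
    (PresentedGroup.toGroup hrel) (fun x => PresentedGroup.toGroup.of _)
    (PresentedGroup.closure_range_of _)
  exact ⟨ℓ, h1, h2, h3, h4⟩

end DefiningGraph

/-- In a large-type Artin group, if `g A_Λ g⁻¹ = A_{Λ'}` for standard parabolic subgroups with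
`|Λ| ≥ 2`, then `Λ = Λ'` and `g ∈ A_Λ`. -/
theorem parabolic_conj_eq {V : Type*} [Fintype V] (Γ : DefiningGraph V)
    (hlarge : ∀ a b : V, Γ.graph.Adj a b → 3 ≤ Γ.label a b)
    (Λ Λ' : Set V) (hΛ : 2 ≤ Λ.ncard) (g : ArtinGroup Γ)
    (h : Subgroup.map (MulAut.conj g).toMonoidHom (parabolic Γ Λ) = parabolic Γ Λ') :
    Λ = Λ' ∧ g ∈ parabolic Γ Λ := by
  obtain ⟨ℓ, hℓ⟩ := DefiningGraph.exists_isLength hlarge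
  refine hℓ.conj_closure (Set.one_lt_ncard_iff_nontrivial.1 hΛ) fun u => ?_
  change u ∈ parabolic Γ Λ ↔ g * u * g⁻¹ ∈ parabolic Γ Λ'
  rw [← h, Subgroup.mem_map]
  constructor
  · exact fun hu => ⟨u, hu, rfl⟩
  · rintro ⟨v, hv, e⟩
    have e : g * v * g⁻¹ = g * u * g⁻¹ := e
    rwa [← mul_left_cancel (mul_right_cancel e)]
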